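/- arXiv:2407.19341 — 5 statements merged into one kernel-verified Lean document; each statement's English description precedes it below -/
import Mathlib

section
/- Let ω ≥ 3 and k ≥ 1 be integers and let ε, c > 0 be real constants. Let G be a finite simple graph with m edges and clique number ω(G) = ω such that t(G) ≤ c·m^(1.5−ε). If m ≥ (2.2·c·ω^(2k))^(1/ε), then s_ℓ(G)/m < 2·(ω^(1/3)/(1 + ω^(1/3)) + 1/ω^k), where ℓ = min{n⁺, ω}. -/
/-- The adjacency matrix of a simple graph over `ℝ` is Hermitian (symmetric). -/
lemma adjMatrix_isHermitian {V : Type*} [Fintype V] (G : SimpleGraph V)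
    [DecidableRel G.Adj] : (G.adjMatrix ℝ).IsHermitian := by
  rw [Matrix.IsHermitian, Matrix.conjTranspose_eq_transpose_of_trivial]
  exact G.isSymm_adjMatrix

lemma aux_trace_pow {V : Type*} [Fintype V] [DecidableEq V] (A : Matrix V V ℝ)
    (hA : A.IsHermitian) (p : ℕ) : (A ^ p).trace = ∑ v, hA.eigenvalues v ^ p := by
  conv_lhs => rw [hA.spectral_theorem, ← map_pow]
  rw [Unitary.conjStarAlgAut_apply, Matrix.trace_mul_comm, ← mul_assoc, Unitary.coe_star_mul_self,
    one_mul, Matrix.diagonal_pow, Matrix.trace_diagonal]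
  simp

lemma aux_tr2 {V : Type*} [Fintype V] [DecidableEq V] (G : SimpleGraph V) [DecidableRel G.Adj] :
    ((G.adjMatrix ℝ) ^ 2).trace = 2 * (G.edgeFinset.card : ℝ) := by
  rw [pow_two, Matrix.trace]
  simp only [Matrix.diag, SimpleGraph.adjMatrix_mul_self_apply_self]
  have := G.sum_degrees_eq_twice_card_edges
  exact_mod_cast this

lemma aux_fiber {V : Type*} [Fintype V] [DecidableEq V] (G : SimpleGraph V) [DecidableRel G.Adj]
    (s : Finset V) (hs : s ∈ G.cliqueFinset 3) :
    ((Finset.univ.filter (fun p : V × V × V =>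
      G.Adj p.1 p.2.1 ∧ G.Adj p.2.1 p.2.2 ∧ G.Adj p.2.2 p.1)).filter
        (fun p => ({p.1, p.2.1, p.2.2} : Finset V) = s)).card ≤ 6 := by
  rw [SimpleGraph.mem_cliqueFinset_iff, SimpleGraph.is3Clique_iff] at hs
  obtain ⟨x, y, z, -, -, -, rfl⟩ := hs
  refine le_trans (Finset.card_le_card (t := {(x,y,z),(x,z,y),(y,x,z),(y,z,x),(z,x,y),(z,y,x)}) ?_)
    Finset.card_le_six
  rintro ⟨a, b, c⟩ h
  simp only [Finset.mem_filter, Finset.mem_univ, true_and] at h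
  obtain ⟨⟨h1, h2, h3⟩, h4⟩ := h
  have n1 := h1.ne
  have n2 := h2.ne
  have n3 := h3.ne
  have ha : a ∈ ({x, y, z} : Finset V) := by rw [← h4]; simp
  have hb : b ∈ ({x, y, z} : Finset V) := by rw [← h4]; simp
  have hc : c ∈ ({x, y, z} : Finset V) := by rw [← h4]; simp
  simp only [Finset.mem_insert, Finset.mem_singleton] at ha hb hc
  simp only [Finset.mem_insert, Finset.mem_singleton, Prod.mk.injEq]
  clear h1 h2 h3 h4
  grind

lemma aux_tr3 {V : Type*} [Fintype V] [DecidableEq V] (G : SimpleGraph V) [DecidableRel G.Adj] :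
    ((G.adjMatrix ℝ) ^ 3).trace ≤ 6 * ((G.cliqueFinset 3).card : ℝ) := by
  have h : ((G.adjMatrix ℝ) ^ 3).trace = ((Finset.univ.filter (fun p : V × V × V =>
      G.Adj p.1 p.2.1 ∧ G.Adj p.2.1 p.2.2 ∧ G.Adj p.2.2 p.1)).card : ℝ) := by
    rw [Finset.card_filter, Nat.cast_sum, Fintype.sum_prod_type]
    simp only [Fintype.sum_prod_type]
    rw [pow_three, Matrix.trace]
    refine Finset.sum_congr rfl fun a _ => ?_
    rw [Matrix.diag, Matrix.mul_apply]
    refine Finset.sum_congr rfl fun b _ => ?_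
    rw [Matrix.mul_apply, Finset.mul_sum]
    refine Finset.sum_congr rfl fun c _ => ?_
    simp only [SimpleGraph.adjMatrix_apply]
    by_cases h1 : G.Adj a b <;> by_cases h2 : G.Adj b c <;> by_cases h3 : G.Adj c a <;>
      simp [h1, h2, h3]
  rw [h]
  have := Finset.card_le_mul_card_image_of_maps_to (t := G.cliqueFinset 3)
    (s := Finset.univ.filter (fun p : V × V × V =>
      G.Adj p.1 p.2.1 ∧ G.Adj p.2.1 p.2.2 ∧ G.Adj p.2.2 p.1))
    (f := fun p => ({p.1, p.2.1, p.2.2} : Finset V)) (by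
      rintro ⟨a, b, c⟩ h
      simp only [Finset.coe_filter, Finset.mem_univ, true_and, Set.mem_ofPred_eq,
        Finset.mem_filter] at h
      simp only [Finset.mem_coe, SimpleGraph.mem_cliqueFinset_iff,
        SimpleGraph.is3Clique_triple_iff]
      exact ⟨h.1, h.2.2.symm, h.2.1⟩) 6 (by
        intro s hs
        have h6 := aux_fiber G s hs
        convert h6 using 1)
  exact_mod_cast this

lemma aux_sums {ι : Type*} [Fintype ι] [DecidableEq ι] (μ : ι → ℝ) (S : Finset ι) (w M T : ℝ)
    (hw : 0 < w) (hS : (S.card : ℝ) ≤ w) (hpos : ∀ i ∈ S, 0 ≤ μ i)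
    (h2 : ∑ i, μ i ^ 2 = M) (h3 : ∑ i, μ i ^ 3 ≤ 6 * T) :
    ∑ i ∈ S, μ i ^ 2 ≤ M ∧
    (∑ i ∈ S, μ i ^ 2) * √((∑ i ∈ S, μ i ^ 2) / w)
      ≤ 6 * T + (M - ∑ i ∈ S, μ i ^ 2) * √(M - ∑ i ∈ S, μ i ^ 2) := by
  set s := ∑ i ∈ S, μ i ^ 2 with hs
  have hs0 : 0 ≤ s := Finset.sum_nonneg fun i _ => sq_nonneg _
  have hc2 : s + ∑ i ∈ Sᶜ, μ i ^ 2 = M := by rw [← h2, hs, Finset.sum_add_sum_compl]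
  have hc3 : ∑ i ∈ S, μ i ^ 3 + ∑ i ∈ Sᶜ, μ i ^ 3 ≤ 6 * T := by
    rw [Finset.sum_add_sum_compl]; exact h3
  have hn : 0 ≤ ∑ i ∈ Sᶜ, μ i ^ 2 := Finset.sum_nonneg fun i _ => sq_nonneg _
  refine ⟨by linarith, ?_⟩
  have hM : M - s = ∑ i ∈ Sᶜ, μ i ^ 2 := by linarith
  have hA : - ∑ i ∈ Sᶜ, μ i ^ 3 ≤ (M - s) * √(M - s) := by
    rw [← Finset.sum_neg_distrib]
    calc ∑ i ∈ Sᶜ, - μ i ^ 3 ≤ ∑ i ∈ Sᶜ, μ i ^ 2 * √(M - s) := by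
          refine Finset.sum_le_sum fun i hi => ?_
          have h1 : μ i ^ 2 ≤ M - s := by
            rw [hM]
            exact Finset.single_le_sum (f := fun i => μ i ^ 2) (fun i _ => sq_nonneg _) hi
          have h4 : -μ i ≤ √(M - s) := Real.le_sqrt_of_sq_le (by simpa using h1)
          nlinarith [mul_le_mul_of_nonneg_left h4 (sq_nonneg (μ i))]
      _ = (M - s) * √(M - s) := by rw [← Finset.sum_mul, ← hM]
  have hB : s * √(s / w) ≤ ∑ i ∈ S, μ i ^ 3 := by
    set r := √(s / w) with hr
    have hr0 : 0 ≤ r := Real.sqrt_nonneg _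
    have hr2 : w * r ^ 2 = s := by
      rw [hr, Real.sq_sqrt (by positivity)]; field_simp
    have h5 : ∑ i ∈ S, (3 / 2 * r * μ i ^ 2 - r ^ 3 / 2) ≤ ∑ i ∈ S, μ i ^ 3 := by
      refine Finset.sum_le_sum fun i hi => ?_
      have := hpos i hi
      nlinarith [mul_nonneg (sq_nonneg (μ i - r)) (by linarith : 0 ≤ 2 * μ i + r)]
    rw [Finset.sum_sub_distrib, ← Finset.mul_sum, ← hs, Finset.sum_const, nsmul_eq_mul] at h5
    have h6 : (S.card : ℝ) * (r ^ 3 / 2) ≤ w * (r ^ 3 / 2) :=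
      mul_le_mul_of_nonneg_right hS (by positivity)
    have h7 : w * (r ^ 3 / 2) = s * r / 2 := by rw [← hr2]; ring
    linarith
  linarith

lemma aux_final (s m w a d T : ℝ) (hm : 0 < m) (hw : 3 ≤ w) (ha : 0 < a) (haw : a ^ 3 = w)
    (hd : 0 < d) (hdw : d * w ≤ 1) (hsM : s ≤ 2 * m)
    (hT : 6 * T ≤ 6 / 2.2 * (m * √m) * d ^ 2)
    (h : s * √(s / w) ≤ 6 * T + (2 * m - s) * √(2 * m - s)) :
    s / m < 2 * (a / (1 + a) + d) := by
  by_contra hcon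
  push Not at hcon
  obtain ⟨x, hx⟩ : ∃ x, s = 2 * m * x := ⟨s / (2 * m), by field_simp⟩
  subst hx
  have hx1 : x ≤ 1 := by nlinarith
  have hxd : a / (1 + a) + d ≤ x := by
    have : 2 * m * x / m = 2 * x := by field_simp
    linarith
  obtain ⟨q, hq⟩ : ∃ q, q = √(1 / (1 + a)) := ⟨_, rfl⟩
  obtain ⟨r, hr⟩ : ∃ r, r = √a := ⟨_, rfl⟩
  have hq0 : 0 < q := by rw [hq]; positivity
  have hr0 : 0 < r := by rw [hr]; positivity
  have hr2 : r ^ 2 = a := by rw [hr, Real.sq_sqrt ha.le]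
  have hq2 : q ^ 2 * (1 + r ^ 2) = 1 := by
    rw [hr2, hq, Real.sq_sqrt (by positivity)]; field_simp
  have hx0 : a / (1 + a) = (r * q) ^ 2 := by
    rw [mul_pow, hr2, hq, Real.sq_sqrt (by positivity)]; field_simp
  have hx0' : 0 ≤ x := le_trans (by positivity) hxd
  rw [hx0] at hxd
  have hsx : r * q ≤ √x := Real.le_sqrt_of_sq_le (by linarith)
  have hs1 : √(1 - x) ≤ q := by
    rw [Real.sqrt_le_left hq0.le]; nlinarith
  have hsw : √w = r ^ 3 := by
    rw [← haw, ← hr2, ← pow_mul, mul_comm, pow_mul, Real.sqrt_sq (by positivity)]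
  have e1 : √(2 * m * x / w) = √2 * √m * √x / r ^ 3 := by
    rw [Real.sqrt_div (by positivity), hsw, Real.sqrt_mul (by positivity),
      Real.sqrt_mul (by positivity)]
  have e2 : √(2 * m - 2 * m * x) = √2 * √m * √(1 - x) := by
    rw [← Real.sqrt_mul (by positivity), ← Real.sqrt_mul (by positivity)]
    congr 1; ring
  rw [e1, e2] at h
  have hsm : 0 < √m := by positivity
  have h2 : 1.41 ≤ √2 := Real.le_sqrt_of_sq_le (by norm_num)
  -- divide by 2 m √2 √m
  have h3 : x * √x / r ^ 3 ≤ (1 - x) * √(1 - x) + 0.97 * d ^ 2 := by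
    have h4 : (2 * m * √2 * √m) * (x * √x / r ^ 3) ≤
        (2 * m * √2 * √m) * ((1 - x) * √(1 - x) + 0.97 * d ^ 2) := by
      have h5 : 6 / 2.2 * (m * √m) * d ^ 2 ≤ (2 * m * √2 * √m) * (0.97 * d ^ 2) := by
        have : 6 / 2.2 * (m * √m * d ^ 2) ≤ (2 * √2 * 0.97) * (m * √m * d ^ 2) :=
          mul_le_mul_of_nonneg_right (by norm_num at h2 ⊢; linarith) (by positivity)
        linarith
      have h6 : (2 * m * √2 * √m) * (x * √x / r ^ 3) =
        2 * m * x * (√2 * √m * √x / r ^ 3) := by ring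
      rw [h6]
      linarith
    exact le_of_mul_le_mul_left h4 (by positivity)
  have h7 : ((r * q) ^ 2 + d) * (r * q) ≤ x * √x := mul_le_mul hxd hsx (by positivity) hx0'
  have h8 : (1 - x) * √(1 - x) ≤ q ^ 2 * q :=
    mul_le_mul (by nlinarith) hs1 (Real.sqrt_nonneg _) (by positivity)
  have h9 : x * √x ≤ (q ^ 2 * q + 0.97 * d ^ 2) * r ^ 3 := by
    rw [div_le_iff₀ (by positivity)] at h3
    refine h3.trans (mul_le_mul_of_nonneg_right (by linarith) (by positivity))
  have h10 : (d * r) * q ≤ (d * r) * (0.97 * d * r ^ 2) := by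
    have h17 := h7.trans h9
    linear_combination h17
  have h11 : q ≤ 0.97 * d * r ^ 2 := le_of_mul_le_mul_left h10 (by positivity)
  have hw6 : w = r ^ 6 := by rw [← haw, ← hr2]; ring
  rw [hw6] at hdw hw
  have h12 : q * r ^ 4 ≤ 0.97 := by
    have h17 := mul_le_mul_of_nonneg_right h11 (by positivity : 0 ≤ r ^ 4)
    have h18 : 0.97 * d * r ^ 2 * r ^ 4 = 0.97 * (d * r ^ 6) := by ring
    rw [h18] at h17
    linarith
  have h13 : (q * r ^ 4) ^ 2 ≤ 0.97 ^ 2 := pow_le_pow_left₀ (by positivity) h12 2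
  have h14 : (q * r ^ 4) ^ 2 * (1 + r ^ 2) = r ^ 8 := by
    linear_combination r ^ 8 * hq2
  have h15 : 1 ≤ r ^ 2 := by
    by_contra hh
    push Not at hh
    have h17 : (r ^ 2) ^ 3 ≤ 1 := pow_le_one₀ (by positivity) hh.le
    rw [← pow_mul] at h17
    norm_num at h17
    linarith
  have h16 : r ^ 8 ≤ 1 + r ^ 2 := by
    rw [← h14]
    have h17 : (q * r ^ 4) ^ 2 ≤ 1 := h13.trans (by norm_num)
    exact mul_le_of_le_one_left (by positivity) h17
  have h18 : r ^ 8 = r ^ 6 * r ^ 2 := by ring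
  have h19 : 3 * r ^ 2 ≤ r ^ 6 * r ^ 2 := mul_le_mul_of_nonneg_right hw (by positivity)
  linarith

/-- **Theorem (main).** Let `ω ≥ 3`, `k ≥ 1` be integers, `ε, c > 0` reals. If `G` has `m`
edges, clique number `ω`, at most `c·m^(1.5−ε)` triangles, and
`m ≥ (2.2·c·ω^(2k))^(1/ε)`, then `s_ℓ(G)/m < 2(ω^(1/3)/(1+ω^(1/3)) + 1/ω^k)` where
`ℓ = min{n⁺, ω}`, `n⁺` is the number of positive eigenvalues, and
`s_ℓ` the sum of squares of the `ℓ` largest eigenvalues `μ 0 ≥ μ 1 ≥ ⋯`. -/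
theorem stmt_0 {V : Type*} [Fintype V] [DecidableEq V]
    (G : SimpleGraph V) [DecidableRel G.Adj]
    (ω k : ℕ) (hω : 3 ≤ ω) (hk : 1 ≤ k) (hclique : G.cliqueNum = ω)
    (ε c : ℝ) (hε : 0 < ε) (hc : 0 < c)
    (m : ℕ) (hm : G.edgeFinset.card = m)
    (μ : Fin (Fintype.card V) → ℝ) (hanti : Antitone μ)
    (hμ : ∃ e : V ≃ Fin (Fintype.card V),
      ∀ v, (adjMatrix_isHermitian G).eigenvalues v = μ (e v))
    (ht : ((G.cliqueFinset 3).card : ℝ) ≤ c * (m : ℝ) ^ (1.5 - ε))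
    (hedges : (2.2 * c * (ω : ℝ) ^ (2 * k)) ^ (1 / ε) ≤ (m : ℝ)) :
    (∑ i ∈ Finset.univ.filter
        (fun i : Fin (Fintype.card V) =>
          (i : ℕ) < min ((Finset.univ.filter fun j => 0 < μ j).card) ω),
        μ i ^ 2) / (m : ℝ)
      < 2 * ((ω : ℝ) ^ ((1 : ℝ) / 3) / (1 + (ω : ℝ) ^ ((1 : ℝ) / 3)) + 1 / (ω : ℝ) ^ k) := by
  have hw3 : (3 : ℝ) ≤ (ω : ℝ) := by exact_mod_cast hω
  have hw0 : (0 : ℝ) < (ω : ℝ) := by linarith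
  have hb : 0 < 2.2 * c * (ω : ℝ) ^ (2 * k) := by positivity
  have hm0 : (0 : ℝ) < (m : ℝ) := lt_of_lt_of_le (Real.rpow_pos_of_pos hb _) hedges
  have hme : 2.2 * c * (ω : ℝ) ^ (2 * k) ≤ (m : ℝ) ^ ε := by
    have := Real.rpow_le_rpow (Real.rpow_nonneg hb.le _) hedges hε.le
    rwa [← Real.rpow_mul hb.le, one_div, inv_mul_cancel₀ hε.ne', Real.rpow_one] at this
  obtain ⟨e, he⟩ := hμ
  have hsum : ∀ p : ℕ, ∑ i, μ i ^ p = ((G.adjMatrix ℝ) ^ p).trace := by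
    intro p
    rw [aux_trace_pow _ (adjMatrix_isHermitian G), ← e.sum_comp]
    simp [he]
  have key := aux_sums μ (Finset.univ.filter
        (fun i : Fin (Fintype.card V) =>
          (i : ℕ) < min ((Finset.univ.filter fun j => 0 < μ j).card) ω)) ω (2 * m)
    (G.cliqueFinset 3).card hw0 (by
      norm_cast
      have h1 := Finset.card_le_card_of_injOn (s := Finset.univ.filter
        (fun i : Fin (Fintype.card V) =>
          (i : ℕ) < min ((Finset.univ.filter fun j => 0 < μ j).card) ω))
        (t := Finset.range ω) (fun i => (i : ℕ)) (by
          intro i hi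
          simp only [Finset.coe_filter, Finset.mem_univ, true_and, Set.mem_ofPred_eq,
            lt_min_iff] at hi
          simpa using hi.2) (fun i _ j _ h => Fin.ext h)
      simpa using h1) (by
      intro i hi
      simp only [Finset.mem_filter, Finset.mem_univ, true_and, lt_min_iff] at hi
      by_contra hneg
      push Not at hneg
      have h1 : (Finset.univ.filter fun j => 0 < μ j) ⊆ Finset.Iio i := by
        intro j hj
        simp only [Finset.mem_filter, Finset.mem_univ, true_and] at hj
        rw [Finset.mem_Iio]
        by_contra hij
        push Not at hij
        have := hanti hij
        linarith
      have h2 := Finset.card_le_card h1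
      rw [Fin.card_Iio] at h2
      omega)
    (by rw [hsum, aux_tr2, hm]) (by rw [hsum]; exact aux_tr3 G)
  obtain ⟨k1, k2⟩ := key
  refine aux_final _ m ω ((ω : ℝ) ^ ((1 : ℝ) / 3)) (1 / (ω : ℝ) ^ k) (G.cliqueFinset 3).card hm0 hw3
    (by positivity) ?_ (by positivity) ?_ k1 ?_ k2
  · rw [← Real.rpow_natCast, ← Real.rpow_mul hw0.le]; norm_num
  · rw [one_div, inv_mul_le_one₀ (by positivity)]
    exact le_self_pow₀ (by linarith) (by omega)
  · have e1 : (m : ℝ) ^ (1.5 - ε) = (m * √m) / (m : ℝ) ^ ε := by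
      rw [Real.rpow_sub hm0, Real.sqrt_eq_rpow]
      congr 1
      rw [show (1.5 : ℝ) = 1 + 1 / 2 by norm_num, Real.rpow_add hm0, Real.rpow_one]
    have hp : 0 < (m : ℝ) ^ ε := by positivity
    have e2 : c * (m : ℝ) ^ (1.5 - ε) ≤ 1 / 2.2 * (m * √m) * (1 / (ω : ℝ) ^ k) ^ 2 := by
      rw [e1, ← mul_div_assoc, div_le_iff₀ hp]
      have h1 : (1 / (ω : ℝ) ^ k) ^ 2 * (ω : ℝ) ^ (2 * k) = 1 := by
        rw [div_pow, one_pow, ← pow_mul, mul_comm k 2]; field_simp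
      have h2 : 0 ≤ 1 / 2.2 * ((m : ℝ) * √m) * (1 / (ω : ℝ) ^ k) ^ 2 := by positivity
      have h3 := mul_le_mul_of_nonneg_left hme h2
      refine le_trans (le_of_eq ?_) h3
      linear_combination (-(c * ((m : ℝ) * √m))) * h1
    have := ht.trans e2
    norm_num at this ⊢
    linarith
end

section
/- Let G be a finite simple graph with m ≥ 2 edges. Then λ₁² + λ₂² ≤ m + (3·t(G))^(2/3). -/
section Helpers
open Finset

lemma le_of_sq_aux {x y : ℝ} (h : x ^ 2 ≤ y ^ 2) (hy : 0 ≤ y) : x ≤ y :=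
  (abs_le_of_sq_le_sq' h hy).2

lemma aux_two (a e d r : ℝ) (hr : 0 ≤ r) (hd : 0 ≤ d) (he : 0 ≤ e) (ha : 0 ≤ a)
    (hda : d ≤ a) (hed : e ≤ d) (h : d^2 + r^2 = a^2 + e^2) : d^3 + r^3 ≤ a^3 + e^3 := by
  have key : ∀ u v : ℝ, 0 ≤ u → 0 ≤ v → 3 * v * (u^2 - v^2) ≤ 2 * (u^3 - v^3) := by
    intro u v hu hv
    nlinarith [mul_nonneg (sq_nonneg (u - v)) (by linarith : 0 ≤ 2*u+v)]
  rcases le_total r d with hrd | hrd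
  · have h1 := key a d ha hd
    have h2 := key e r he hr
    have h3 : a^2 - d^2 = r^2 - e^2 := by linarith
    have h4 : 0 ≤ a^2 - d^2 := by nlinarith
    have h5 : r * (a^2-d^2) ≤ d * (a^2-d^2) := mul_le_mul_of_nonneg_right hrd h4
    have h6 : r * (a^2-d^2) = r * (r^2-e^2) := by rw [h3]
    nlinarith
  · have h1 := key a r ha hr
    have h2 := key e d he hd
    have h3 : a^2 - r^2 = d^2 - e^2 := by linarith
    have h4 : 0 ≤ a^2 - r^2 := by nlinarith
    have h5 : d * (a^2-r^2) ≤ r * (a^2-r^2) := mul_le_mul_of_nonneg_right hrd h4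
    have h6 : d * (a^2-r^2) = d * (d^2-e^2) := by rw [h3]
    nlinarith

lemma aux_one {V : Type*} (s : Finset V) (d : V → ℝ) (r : ℝ) (hr : 0 ≤ r)
    (hd : ∀ i ∈ s, 0 ≤ d i) (h : ∑ i ∈ s, d i ^ 2 ≤ r ^ 2) : ∑ i ∈ s, d i ^ 3 ≤ r ^ 3 := by
  have h1 : ∀ i ∈ s, d i ≤ r := by
    intro i hi
    have := single_le_sum (f := fun i => d i ^ 2) (fun j _ => sq_nonneg (d j)) hi
    exact abs_le_of_sq_le_sq' (this.trans h) hr |>.2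
  calc ∑ i ∈ s, d i ^ 3 ≤ ∑ i ∈ s, r * d i ^ 2 := by
        apply sum_le_sum
        intro i hi
        nlinarith [h1 i hi, sq_nonneg (d i)]
    _ = r * ∑ i ∈ s, d i ^ 2 := by rw [mul_sum]
    _ ≤ r * r^2 := mul_le_mul_of_nonneg_left h hr
    _ = r ^ 3 := by ring

lemma aux_major {V : Type*} [DecidableEq V] (s : Finset V) (d : V → ℝ) (a e : ℝ) (ha : 0 ≤ a)
    (he : 0 ≤ e) (hea : e ≤ a)
    (hd : ∀ i ∈ s, 0 ≤ d i) (hda : ∀ i ∈ s, d i ≤ a) (h : ∑ i ∈ s, d i ^ 2 ≤ a ^ 2 + e ^ 2) :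
    ∑ i ∈ s, d i ^ 3 ≤ a ^ 3 + e ^ 3 := by
  by_cases hall : ∀ i ∈ s, d i ≤ e
  · calc ∑ i ∈ s, d i ^ 3 ≤ ∑ i ∈ s, e * d i ^ 2 := by
          apply sum_le_sum
          intro i hi
          nlinarith [hall i hi, sq_nonneg (d i)]
      _ = e * ∑ i ∈ s, d i ^ 2 := by rw [mul_sum]
      _ ≤ e * (a^2 + e^2) := mul_le_mul_of_nonneg_left h he
      _ ≤ a ^ 3 + e ^ 3 := by nlinarith [sq_nonneg a]
  · push Not at hall
    obtain ⟨j, hj, hej⟩ := hall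
    have hs2 := add_sum_erase s (fun i => d i ^ 2) hj
    have hs3 := add_sum_erase s (fun i => d i ^ 3) hj
    have hnn : 0 ≤ a^2 + e^2 - d j ^ 2 := by nlinarith [hd j hj, hda j hj]
    have h1 := aux_one (s.erase j) d (√(a^2 + e^2 - d j ^ 2)) (Real.sqrt_nonneg _)
      (fun i hi => hd i (mem_of_mem_erase hi)) (by rw [Real.sq_sqrt hnn]; linarith)
    have h2 := aux_two a e (d j) (√(a^2 + e^2 - d j ^ 2)) (Real.sqrt_nonneg _) (hd j hj) he ha
      (hda j hj) hej.le (by rw [Real.sq_sqrt hnn]; ring)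
    linarith

/-- numeric core, nonneg case -/
lemma core_pos {V : Type*} [DecidableEq V] (s : Finset V) (d : V → ℝ) (a b z : ℝ)
    (hb : 0 ≤ b) (hba : b ≤ a) (hz : 0 ≤ z)
    (hd : ∀ i ∈ s, 0 ≤ d i) (hda : ∀ i ∈ s, d i ≤ a)
    (h : ∑ i ∈ s, d i ^ 2 ≤ a ^ 2 + b ^ 2 - 2 * z ^ 2) :
    2 * z ^ 3 + ∑ i ∈ s, d i ^ 3 ≤ a ^ 3 + b ^ 3 := by
  have ha : 0 ≤ a := hb.trans hba
  have h0 : 0 ≤ ∑ i ∈ s, d i ^ 2 := sum_nonneg fun i _ => sq_nonneg _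
  rcases le_total (2 * z^2) (b^2) with hc | hc
  · obtain ⟨e, he, hes⟩ : ∃ e : ℝ, 0 ≤ e ∧ e^2 = b^2 - 2*z^2 :=
      ⟨√(b^2 - 2*z^2), Real.sqrt_nonneg _, Real.sq_sqrt (by linarith)⟩
    have hea : e ≤ a := by
      refine le_of_sq_aux ?_ ha
      nlinarith
    have h1 := aux_major s d a e ha he hea hd hda (by linarith)
    have h2 : e^3 + 2*z^3 ≤ b^3 := by
      refine le_of_sq_aux ?_ (by positivity)
      have : (b^3)^2 = (e^2 + 2*z^2)^3 := by rw [hes]; ring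
      rw [this]
      nlinarith [mul_nonneg (mul_nonneg (sq_nonneg e) (sq_nonneg z))
        (by nlinarith [sq_nonneg (e - z), sq_nonneg e, sq_nonneg z] : 0 ≤ 6*e^2+12*z^2-4*e*z), pow_nonneg hz 6]
    linarith
  · obtain ⟨τ, hτ, hτs⟩ : ∃ e : ℝ, 0 ≤ e ∧ e^2 = a^2 + b^2 - 2*z^2 :=
      ⟨√(a^2 + b^2 - 2*z^2), Real.sqrt_nonneg _, Real.sq_sqrt (by linarith)⟩
    obtain ⟨w, hw, hws⟩ : ∃ e : ℝ, 0 ≤ e ∧ e^2 = 2*z^2 - b^2 :=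
      ⟨√(2*z^2 - b^2), Real.sqrt_nonneg _, Real.sq_sqrt (by linarith)⟩
    have h1 := aux_one s d τ hτ hd (by linarith)
    have h2 : τ^3 + w^3 ≤ a^3 := by
      have := aux_one (univ : Finset (Fin 2)) ![τ, w] a ha
        (by intro i _; fin_cases i <;> simp [hτ, hw]) (by simp; linarith)
      simpa using this
    have key : ∀ u v : ℝ, 0 ≤ u → 0 ≤ v → 3 * v * (u^2 - v^2) ≤ 2 * (u^3 - v^3) := by
      intro u v hu hv
      nlinarith [mul_nonneg (sq_nonneg (u - v)) (by linarith : 0 ≤ 2*u+v)]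
    have h3 := key b z hb hz
    have h4 := key w z hw hz
    rw [hws] at h4
    nlinarith

/-- numeric core, negative case -/
lemma core_neg {V : Type*} [DecidableEq V] (s : Finset V) (c : V → ℝ) (a b z : ℝ)
    (hb : 0 ≤ b) (hz : 0 ≤ z) (hc : ∀ i ∈ s, b ≤ c i) (i j : V) (hi : i ∈ s) (hj : j ∈ s)
    (hij : i ≠ j) (hsum : ∑ i ∈ s, c i = a) 
    (h : a ^ 2 + 2 * b ^ 2 - ∑ i ∈ s, c i ^ 2 = 2 * z ^ 2) :
    2 * z ^ 3 + ∑ i ∈ s, c i ^ 3 ≤ a ^ 3 := by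
  have pair : ∀ f : V → ℝ, (∀ k ∈ s, 0 ≤ f k) → f i + f j ≤ ∑ k ∈ s, f k := by
    intro f hf
    rw [← sum_pair hij]
    apply sum_le_sum_of_subset_of_nonneg
    · intro k hk; simp at hk; rcases hk with rfl | rfl <;> assumption
    · intro k hk _; exact hf k hk
  have hcn : ∀ k ∈ s, 0 ≤ c k := fun k hk => hb.trans (hc k hk)
  have ha2 : 2 * b ≤ a := by
    have := pair c hcn
    linarith [hc i hi, hc j hj]
  have hrest : ∀ k ∈ s, 0 ≤ a - c k := by
    intro k hk
    have := single_le_sum (f := c) hcn hk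
    linarith
  have hp2 : 2 * b^2 ≤ ∑ k ∈ s, c k ^ 2 := by
    have := pair (fun k => c k ^ 2) (fun k _ => sq_nonneg _)
    nlinarith [hc i hi, hc j hj]
  have hQe : ∑ k ∈ s, c k * (a - c k) = a^2 - ∑ k ∈ s, c k ^ 2 := by
    simp only [mul_sub, sum_sub_distrib, ← sum_mul, hsum]
    simp only [pow_two]
  set Q := ∑ k ∈ s, c k * (a - c k) with hQ
  have hQ2 : 2 * b^2 ≤ Q := by
    have h1 := pair (fun k => c k * (a - c k)) (fun k hk => mul_nonneg (hcn k hk) (hrest k hk))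
    have h2 := pair c hcn
    have h3 : b ≤ a - c i := by linarith [hc j hj]
    have h4 : b ≤ a - c j := by linarith [hc i hi]
    have h5 := mul_le_mul (hc i hi) h3 hb (hcn i hi)
    have h6 := mul_le_mul (hc j hj) h4 hb (hcn j hj)
    nlinarith
  have hR : 0 ≤ ∑ k ∈ s, (c k * (c k - b) * (a - c k)) :=
    sum_nonneg fun k hk => mul_nonneg (mul_nonneg (hcn k hk) (by linarith [hc k hk])) (hrest k hk)
  have hRe : ∑ k ∈ s, (c k * (c k - b) * (a - c k))
      = a * ∑ k ∈ s, c k ^ 2 - ∑ k ∈ s, c k ^ 3 - b * Q := by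
    rw [hQ, mul_sum, mul_sum, ← sum_sub_distrib, ← sum_sub_distrib]
    exact sum_congr rfl fun k _ => by ring
  have hT : Q * (a + b) ≤ a^3 - ∑ k ∈ s, c k ^ 3 := by
    have : a ^ 3 = a * (Q + ∑ k ∈ s, c k ^ 2) := by rw [hQe]; ring
    rw [this]; nlinarith
  have hz2 : z^2 = b^2 + Q/2 := by linarith
  have hQn : 0 ≤ Q := by nlinarith
  have hfin : 2 * z^3 ≤ Q * (a+b) := by
    refine le_of_sq_aux ?_ (by apply mul_nonneg hQn; linarith)
    have e1 : (2 * z^3)^2 = 4 * (b^2 + Q/2)^3 := by rw [← hz2]; ring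
    have e2 : Q + 7 * b^2 ≤ (a+b)^2 := by nlinarith
    have e3 : Q^2 * (Q + 7*b^2) ≤ Q^2 * (a+b)^2 := mul_le_mul_of_nonneg_left e2 (sq_nonneg _)
    rw [e1, mul_pow]
    refine le_trans ?_ e3
    obtain ⟨β, hβ⟩ : ∃ β, β = b^2 := ⟨_, rfl⟩
    have hβ0 : 0 ≤ β := by rw [hβ]; positivity
    rw [← hβ] at hQ2 ⊢
    obtain ⟨u, hu⟩ : ∃ u, u = Q - 2*β := ⟨_, rfl⟩
    have hu0 : 0 ≤ u := by linarith
    have : Q = u + 2*β := by linarith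
    rw [this]
    have : 0 ≤ (u + 2*β)^2*(u+2*β+7*β) - 4*(β+(u+2*β)/2)^3 := by ring_nf; positivity
    linarith
  linarith

lemma perron {V : Type*} [Fintype V] (lam : V → ℝ) (p : V) (hp : ∀ v, lam v ≤ lam p)
    (hk : ∀ k : ℕ, 0 ≤ ∑ v, lam v ^ (2*k+1)) (v : V) : - lam v ≤ lam p := by
  classical
  have hp0 : 0 ≤ lam p := by
    by_contra hneg
    push Not at hneg
    have h0 := hk 0
    have : ∑ v, lam v ^ (2*0+1) < 0 := by
      apply sum_neg
      · intro i _; simpa using lt_of_le_of_lt (hp i) hneg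
      · exact ⟨p, mem_univ _⟩
    linarith
  by_contra hlt
  push Not at hlt
  set a := lam p
  set d := - lam v with hd
  have hdpos : 0 < d := lt_of_le_of_lt hp0 hlt
  have hbd : ∀ k : ℕ, d^(2*k+1) ≤ (Fintype.card V : ℝ) * a^(2*k+1) := by
    intro k
    have h1 := hk k
    rw [← add_sum_erase univ _ (mem_univ v)] at h1
    have hodd : Odd (2*k+1) := ⟨k, rfl⟩
    have h2 : lam v ^ (2*k+1) = - d^(2*k+1) := by
      rw [← hodd.neg_pow, hd, neg_neg]
    have h3 : ∑ w ∈ univ.erase v, lam w ^ (2*k+1) ≤ ∑ w ∈ univ.erase v, a ^ (2*k+1) :=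
      sum_le_sum fun w _ => hodd.strictMono_pow.monotone (hp w)
    have h4 : ∑ w ∈ univ.erase v, a ^ (2*k+1) ≤ ∑ w : V, a ^ (2*k+1) :=
      sum_le_sum_of_subset_of_nonneg (erase_subset _ _) fun _ _ _ => by positivity
    have h5 : ∑ w : V, a ^ (2*k+1) = (Fintype.card V : ℝ) * a^(2*k+1) := by simp
    linarith
  have hq0 : 0 ≤ a / d := by positivity
  have hq1 : a / d < 1 := by rw [div_lt_one hdpos]; exact hlt
  have hn : (0:ℝ) < Fintype.card V := by
    have : 0 < Fintype.card V := Fintype.card_pos_iff.2 ⟨v⟩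
    exact_mod_cast this
  obtain ⟨k, hk'⟩ := exists_pow_lt_of_lt_one (inv_pos.2 hn) hq1
  have h1 : (a/d)^(2*k+1) ≤ (a/d)^k := pow_le_pow_of_le_one hq0 hq1.le (by omega)
  have h2 : (a/d)^(2*k+1) < (Fintype.card V : ℝ)⁻¹ := lt_of_le_of_lt h1 hk'
  rw [div_pow, div_lt_iff₀ (by positivity), ← div_eq_inv_mul, lt_div_iff₀ hn] at h2
  linarith [hbd k]


lemma trace_pow_eig {V : Type*} [Fintype V] [DecidableEq V] (A : Matrix V V ℝ)
    (hA : A.IsHermitian) (k : ℕ) : (A ^ k).trace = ∑ v, hA.eigenvalues v ^ k := by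
  conv_lhs => rw [hA.spectral_theorem]
  rw [← map_pow, Matrix.diagonal_pow, Unitary.conjStarAlgAut_apply, Matrix.trace_mul_cycle]
  simp [Matrix.trace_diagonal]

lemma trace_cube_le {V : Type*} [Fintype V] [DecidableEq V] (G : SimpleGraph V)
    [DecidableRel G.Adj] : (G.adjMatrix ℝ ^ 3).trace ≤ 6 * ((G.cliqueFinset 3).card : ℝ) := by
  classical
  set S : Finset (V × V × V) := univ.filter fun x =>
    G.Adj x.1 x.2.1 ∧ G.Adj x.2.1 x.2.2 ∧ G.Adj x.2.2 x.1 with hS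
  have h1 : (G.adjMatrix ℝ ^ 3).trace = (S.card : ℝ) := by
    rw [hS, card_filter, Nat.cast_sum, Fintype.sum_prod_type]
    simp only [Fintype.sum_prod_type, Matrix.trace, Matrix.diag, pow_succ, pow_zero, one_mul,
      Matrix.mul_apply, SimpleGraph.adjMatrix_apply, sum_mul]
    refine sum_congr rfl fun i _ => ?_
    rw [sum_comm]
    refine sum_congr rfl fun j _ => sum_congr rfl fun k _ => ?_
    by_cases h1 : G.Adj i j <;> by_cases h2 : G.Adj j k <;> by_cases h3 : G.Adj k i <;>
      simp [h1, h2, h3]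
  have h2 : S.card ≤ 6 * (G.cliqueFinset 3).card := by
    refine card_le_mul_card_image_of_maps_to (f := fun x : V × V × V => ({x.1, x.2.1, x.2.2} : Finset V)) ?_ 6 ?_
    · rintro ⟨i, j, k⟩ hx
      simp only [hS, mem_filter, mem_univ, true_and] at hx
      rw [SimpleGraph.mem_cliqueFinset_iff, SimpleGraph.is3Clique_triple_iff]
      exact ⟨hx.1, hx.2.2.symm, hx.2.1⟩
    · intro t ht
      rw [SimpleGraph.mem_cliqueFinset_iff, SimpleGraph.is3Clique_iff] at ht
      obtain ⟨a, b, c, hab, hac, hbc, rfl⟩ := ht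
      have hsub : (S.filter fun x => ({x.1, x.2.1, x.2.2} : Finset V) = {a, b, c}) ⊆
          {(a,b,c),(a,c,b),(b,a,c),(b,c,a),(c,a,b),(c,b,a)} := by
        rintro ⟨i, j, k⟩ hx
        simp only [hS, mem_filter, mem_univ, true_and] at hx
        obtain ⟨⟨hij, hjk, hki⟩, he⟩ := hx
        have hi : i ∈ ({a,b,c} : Finset V) := by rw [← he]; simp
        have hj : j ∈ ({a,b,c} : Finset V) := by rw [← he]; simp
        have hk : k ∈ ({a,b,c} : Finset V) := by rw [← he]; simp
        have h1 := hij.ne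
        have h2 := hjk.ne
        have h3 := hki.ne
        simp only [mem_insert, mem_singleton] at hi hj hk
        simp only [mem_insert, mem_singleton, Prod.mk.injEq]
        clear he hij hjk hki hab hac hbc
        rcases hi with rfl | rfl | rfl <;> rcases hj with rfl | rfl | rfl <;>
          rcases hk with rfl | rfl | rfl <;> simp_all
      exact (card_le_card hsub).trans card_le_six
  rw [h1]
  exact_mod_cast h2

lemma final_aux {V : Type*} [Fintype V] [DecidableEq V] (lam : V → ℝ) (p q : V) (hpq : p ≠ q)
    (hp : ∀ v, lam v ≤ lam p) (hq : ∀ v, v ≠ p → lam v ≤ lam q)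
    (hneg : ∀ v, - lam v ≤ lam p) (h0 : ∑ v, lam v = 0) (hcard : 3 ≤ Fintype.card V)
    (m z : ℝ) (hz : 0 ≤ z) (h2 : ∑ v, lam v ^ 2 = 2 * m)
    (hx : lam p ^ 2 + lam q ^ 2 = m + z ^ 2) : 2 * z ^ 3 ≤ ∑ v, lam v ^ 3 := by
  rcases le_or_gt 0 (lam q) with hq0 | hq0
  · set R : Finset V := (univ.erase p).erase q with hR
    have hqm : q ∈ univ.erase p := by simp [hpq.symm]
    have split : ∀ f : V → ℝ, ∑ v, f v = f p + (f q + ∑ v ∈ R, f v) := fun f => by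
      rw [← add_sum_erase univ f (mem_univ p), ← add_sum_erase _ f hqm]
    set N := R.filter fun v => lam v < 0 with hN
    have hle2 : ∑ v ∈ N, (- lam v) ^ 2 ≤ ∑ v ∈ R, lam v ^ 2 := by
      simp only [neg_sq]
      exact sum_le_sum_of_subset_of_nonneg (filter_subset _ _) fun _ _ _ => sq_nonneg _
    have hle3 : - ∑ v ∈ N, (- lam v) ^ 3 ≤ ∑ v ∈ R, lam v ^ 3 := by
      rw [hN, sum_filter, ← sum_neg_distrib]
      apply sum_le_sum
      intro v _
      split_ifs with h
      · apply le_of_eq; ring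
      · push Not at h
        simp only [neg_zero]; positivity
    have e2 := split fun v => lam v ^ 2
    have e3 := split fun v => lam v ^ 3
    have := core_pos N (fun v => - lam v) (lam p) (lam q) z hq0 (hp q) hz
      (fun v hv => by
        have := (mem_filter.1 hv).2
        linarith) (fun v _ => hneg v) (by linarith)
    linarith
  · set R : Finset V := univ.erase p with hR
    have split : ∀ f : V → ℝ, ∑ v, f v = f p + ∑ v ∈ R, f v := fun f => by
      rw [← add_sum_erase univ f (mem_univ p)]
    obtain ⟨r, hr⟩ : ∃ r, r ∈ R.erase q := by
      apply card_pos.1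
      rw [card_erase_of_mem (by simp [hR, hpq.symm]), card_erase_of_mem (mem_univ _), card_univ]
      omega
    have e1 := split lam
    have e2 := split fun v => lam v ^ 2
    have e3 := split fun v => lam v ^ 3
    have hodd : ∑ v ∈ R, (- lam v) ^ 3 = - ∑ v ∈ R, lam v ^ 3 := by
      rw [← sum_neg_distrib]; exact sum_congr rfl fun _ _ => by ring
    have := core_neg R (fun v => - lam v) (lam p) (- lam q) z (by linarith) hz
      (fun v hv => neg_le_neg (hq v (mem_erase.1 hv).1)) r q (mem_of_mem_erase hr)
      (by simp [hR, hpq.symm]) (mem_erase.1 hr).1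
      (by rw [sum_neg_distrib]; linarith) (by simp only [neg_sq]; linarith)
    linarith

end Helpers


/-- **Theorem.** For every graph `G` with `m ≥ 2` edges,
`λ₁² + λ₂² ≤ m + (3·t(G))^(2/3)`, where `λ₁ = μ 0` and `λ₂ = μ 1` are the two largest
eigenvalues of the adjacency matrix (`μ` lists the eigenvalues in non-increasing order;
note `m ≥ 2` forces the graph to have more than one vertex) and `t(G)` is the number of
triangles of `G`. -/
theorem stmt_5 {V : Type*} [Fintype V] [DecidableEq V]
    (G : SimpleGraph V) [DecidableRel G.Adj]
    (m : ℕ) (hm : G.edgeFinset.card = m) (hm2 : 2 ≤ m)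
    (μ : Fin (Fintype.card V) → ℝ) (hanti : Antitone μ)
    (hμ : ∃ e : V ≃ Fin (Fintype.card V),
      ∀ v, (adjMatrix_isHermitian G).eigenvalues v = μ (e v)) :
    ∀ h1 : 1 < Fintype.card V,
      μ ⟨0, by omega⟩ ^ 2 + μ ⟨1, h1⟩ ^ 2
        ≤ (m : ℝ) + (3 * ((G.cliqueFinset 3).card : ℝ)) ^ ((2 : ℝ) / 3) := by
  intro h1
  obtain ⟨e, he⟩ := hμ
  set lam := (adjMatrix_isHermitian G).eigenvalues with hlam
  set p := e.symm ⟨0, by omega⟩ with hp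
  set q := e.symm ⟨1, h1⟩ with hq
  have hlp : lam p = μ ⟨0, by omega⟩ := by rw [he, hp, Equiv.apply_symm_apply]
  have hlq : lam q = μ ⟨1, h1⟩ := by rw [he, hq, Equiv.apply_symm_apply]
  have hpq : p ≠ q := by
    intro h
    have := e.symm.injective h
    simp at this
  have hpm : ∀ v, lam v ≤ lam p := by
    intro v
    rw [hlp, he]
    exact hanti (by rw [Fin.le_def]; simp)
  have hqm : ∀ v, v ≠ p → lam v ≤ lam q := by
    intro v hv
    rw [hlq, he]
    apply hanti
    rw [Fin.le_def]
    have : (e v : ℕ) ≠ 0 := by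
      intro h
      apply hv
      rw [hp, Equiv.eq_symm_apply]
      exact Fin.ext h
    simp only
    omega
  have htr : ∀ k, ∑ v, lam v ^ k = (G.adjMatrix ℝ ^ k).trace := fun k =>
    (trace_pow_eig _ (adjMatrix_isHermitian G) k).symm
  have hnn : ∀ k, 0 ≤ ∑ v, lam v ^ k := by
    intro k
    rw [htr, Matrix.trace]
    apply Finset.sum_nonneg
    intro i _
    rw [Matrix.diag_apply, SimpleGraph.adjMatrix_pow_apply_eq_card_walk]
    positivity
  have hneg := perron lam p hpm (fun k => hnn _)
  have h0 : ∑ v, lam v = 0 := by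
    have := htr 1
    simpa using this
  have h2 : ∑ v, lam v ^ 2 = 2 * (m : ℝ) := by
    rw [htr, Matrix.trace]
    simp only [Matrix.diag_apply, pow_two, SimpleGraph.adjMatrix_mul_self_apply_self]
    rw [← hm]
    exact_mod_cast G.sum_degrees_eq_twice_card_edges
  have hcard : 3 ≤ Fintype.card V := by
    by_contra hlt
    have h2 : Fintype.card V = 2 := by omega
    have := G.card_edgeFinset_le_card_choose_two
    rw [h2, hm] at this
    simp at this
    omega
  rw [← hlp, ← hlq]
  set t : ℝ := ((G.cliqueFinset 3).card : ℝ) with ht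
  have ht0 : 0 ≤ t := by positivity
  rcases le_total (lam p ^ 2 + lam q ^ 2) m with hle | hge
  · have : 0 ≤ (3 * t) ^ ((2:ℝ)/3) := by positivity
    linarith
  · set z := √(lam p ^ 2 + lam q ^ 2 - m) with hz
    have hz0 : 0 ≤ z := Real.sqrt_nonneg _
    have hzs : z ^ 2 = lam p ^ 2 + lam q ^ 2 - m := Real.sq_sqrt (by linarith)
    have h3 := final_aux lam p q hpq hpm hqm hneg h0 hcard m z hz0 h2 (by linarith)
    have h4 := trace_cube_le G
    rw [← htr] at h4
    have h5 : z ^ 3 ≤ 3 * t := by linarith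
    have h6 : z ^ 2 ≤ (3 * t) ^ ((2:ℝ)/3) := by
      have h7 : (z ^ 3) ^ ((2:ℝ)/3) ≤ (3 * t) ^ ((2:ℝ)/3) :=
        Real.rpow_le_rpow (by positivity) h5 (by norm_num)
      have h8 : (z ^ 3) ^ ((2:ℝ)/3) = z ^ 2 := by
        rw [← Real.rpow_natCast z 3, ← Real.rpow_mul hz0, ← Real.rpow_natCast z 2]
        norm_num
      linarith
    linarith
end

section
/- Let k ≥ 4 be an integer and let G be a finite simple graph with m edges that is C_k-free, i.e., G contains no cycle of length k as a subgraph. If m ≥ (10.06·(k−3)·√k/3)², then s_ℓ(G) ≤ 2m·(1 − 1/ω(G)), where ℓ = min{n⁺, ω(G)}. -/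
namespace S8
open SimpleGraph Finset

lemma grow {V : Type*} [DecidableEq V] (G : SimpleGraph V) (S : Finset V) (hS : S.Nonempty) (L : ℕ)
    (H : ∀ u w (p : G.Walk u w), p.IsPath → (∀ x ∈ p.support, x ∈ S) → p.length < L →
      ∃ x ∈ S, G.Adj x u ∧ x ∉ p.support) :
    ∃ u w, ∃ p : G.Walk u w, p.IsPath ∧ (∀ x ∈ p.support, x ∈ S) ∧ p.length = L := by
  induction L with
  | zero =>
    obtain ⟨s, hs⟩ := hS
    exact ⟨s, s, Walk.nil, by simp, by simpa using hs, by simp⟩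
  | succ L ih =>
    obtain ⟨u, w, p, hp, hpS, hl⟩ := ih (fun u w p h1 h2 h3 => H u w p h1 h2 (by omega))
    obtain ⟨x, hx, hxu, hxp⟩ := H u w p hp hpS (by omega)
    refine ⟨x, w, Walk.cons hxu p, ?_, ?_, by simp [hl]⟩
    · rw [Walk.cons_isPath_iff]; exact ⟨hp, hxp⟩
    · intro y hy
      rw [Walk.support_cons, List.mem_cons] at hy
      rcases hy with rfl | hy
      · exact hx
      · exact hpS y hy

lemma noPath {V : Type*} (G : SimpleGraph V) (k : ℕ) (hk : 4 ≤ k)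
    (hCk : ∀ (v : V) (w : G.Walk v v), w.IsCycle → w.length ≠ k) (v : V)
    {u w : V} (p : G.Walk u w) (hp : p.IsPath) (hv : ∀ x ∈ p.support, G.Adj v x) :
    p.length ≠ k - 2 := by
  intro hl
  have hu := hv u p.start_mem_support
  have hw := hv w p.end_mem_support
  have hvp : v ∉ p.support := fun h => (hv v h).ne rfl
  have huw : u ≠ w := by
    rintro rfl
    have := Walk.nil_iff_length_eq.1 (Walk.isPath_iff_nil.1 hp)
    omega
  refine hCk v (Walk.cons hu (p.concat hw.symm)) ?_ (by simp [hl]; omega)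
  rw [Walk.cons_isCycle_iff]
  refine ⟨hp.concat hvp hw.symm, ?_⟩
  rw [Walk.edges_concat]
  simp only [List.concat_eq_append, List.mem_append, List.mem_singleton, not_or]
  refine ⟨fun h => hvp (Walk.fst_mem_support_of_mem_edges p h), ?_⟩
  intro h
  rw [Sym2.eq_iff] at h
  rcases h with ⟨h1, h2⟩ | ⟨h1, h2⟩
  · exact hu.ne h2.symm
  · exact huw h2

lemma deg1 {V : Type*} [DecidableEq V] (G : SimpleGraph V) [DecidableRel G.Adj] (k : ℕ) (hk : 4 ≤ k)
    (hCk : ∀ (v : V) (w : G.Walk v v), w.IsCycle → w.length ≠ k) (v : V)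
    (S : Finset V) (hS : S.Nonempty) (hv : ∀ x ∈ S, G.Adj v x) :
    ∃ u ∈ S, #{x ∈ S | G.Adj u x} ≤ k - 3 := by
  by_contra! hcon
  obtain ⟨u, w, p, hp, hpS, hl⟩ := grow G S hS (k - 2) (by
    intro u w p hp hpS hl
    by_contra! hno
    have h1 := hcon u (hpS u p.start_mem_support)
    have h2 : ({x ∈ S | G.Adj u x} : Finset V) ⊆ p.support.tail.toFinset := by
      intro x hx
      rw [Finset.mem_filter] at hx
      have := hno x hx.1 hx.2.symm
      rw [Walk.mem_support_iff] at this
      rcases this with rfl | h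
      · exact absurd rfl hx.2.ne
      · simpa using h
    have h3 := Finset.card_le_card h2
    have h4 := p.support.tail.toFinset_card_le
    have h5 : p.support.tail.length = p.length := by simp
    omega)
  exact noPath G k hk hCk v p hp (fun x hx => hv x (hpS x hx)) hl

lemma countChain {V : Type*} (G : SimpleGraph V) [DecidableRel G.Adj] (x : V) : ∀ (l : List V),
    l.IsChain G.Adj → (∀ a ∈ l, ∀ b ∈ l, G.Adj a b → G.Adj x a → ¬ G.Adj x b) →
    l.countP (fun y => G.Adj x y) ≤ (l.length + 1) / 2
  | [], _, _ => by simp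
  | [a], _, _ => by
    have := List.countP_le_length (p := fun y => decide (G.Adj x y)) (l := [a])
    simpa using this
  | a :: b :: l, hc, h => by
    have ih := countChain G x l (by
      rw [List.isChain_cons_cons] at hc
      exact hc.2.tail) (fun a ha b hb => h a (by simp [ha]) b (by simp [hb]))
    rw [List.isChain_cons_cons] at hc
    have hab := h a (by simp) b (by simp) hc.1
    simp only [List.countP_cons, List.length_cons]
    by_cases ha : G.Adj x a <;> by_cases hb : G.Adj x b <;> simp_all <;> omega

lemma deg2 {V : Type*} [DecidableEq V] (G : SimpleGraph V) [DecidableRel G.Adj] (k : ℕ) (hk : 4 ≤ k)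
    (hCk : ∀ (v : V) (w : G.Walk v v), w.IsCycle → w.length ≠ k) (v : V)
    (hfour : ∀ a b c, G.Adj v a → G.Adj v b → G.Adj v c → G.Adj a b → G.Adj a c → ¬ G.Adj b c)
    (S : Finset V) (hS : S.Nonempty) (hv : ∀ x ∈ S, G.Adj v x) :
    ∃ u ∈ S, #{x ∈ S | G.Adj u x} ≤ (k - 2) / 2 := by
  by_contra! hcon
  obtain ⟨u, w, p, hp, hpS, hl⟩ := grow G S hS (k - 2) (by
    intro u w p hp hpS hl
    by_contra! hno
    have hu := hpS u p.start_mem_support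
    have h1 := hcon u hu
    have h2 : ({x ∈ S | G.Adj u x} : Finset V) ⊆
        (p.support.tail.filter (fun y => G.Adj u y)).toFinset := by
      intro x hx
      rw [Finset.mem_filter] at hx
      have := hno x hx.1 hx.2.symm
      rw [Walk.mem_support_iff] at this
      rcases this with rfl | h
      · exact absurd rfl hx.2.ne
      · simpa using ⟨h, hx.2⟩
    have h3 := Finset.card_le_card h2
    have h4 := (p.support.tail.filter (fun y => G.Adj u y)).toFinset_card_le
    rw [← List.countP_eq_length_filter] at h4
    have h5 : p.support.tail.length = p.length := by simp
    have h6 := countChain G u p.support.tail p.isChain_adj_support.tail (by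
      intro a ha b hb hab hua hub
      have ha' := hpS a (List.mem_of_mem_tail ha)
      have hb' := hpS b (List.mem_of_mem_tail hb)
      exact hfour u a b (hv u hu) (hv a ha') (hv b hb') hua hub hab)
    omega)
  exact noPath G k hk hCk v p hp (fun x hx => hv x (hpS x hx)) hl

lemma degen {V : Type*} [DecidableEq V] (G : SimpleGraph V) [DecidableRel G.Adj] (d : ℕ) :
    ∀ (n : ℕ) (S : Finset V), #S = n →
    (∀ S' ⊆ S, S'.Nonempty → ∃ u ∈ S', #{x ∈ S' | G.Adj u x} ≤ d) →
    ∑ u ∈ S, #{x ∈ S | G.Adj u x} ≤ 2 * d * n := by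
  intro n
  induction n with
  | zero => intro S hS _; rw [Finset.card_eq_zero] at hS; simp [hS]
  | succ n ih =>
    intro S hS H
    obtain ⟨u, hu, hd⟩ := H S subset_rfl (by rw [← Finset.card_pos]; omega)
    have ih' := ih (S.erase u) (by rw [Finset.card_erase_of_mem hu]; omega)
      (fun S' h1 h2 => H S' (h1.trans (Finset.erase_subset _ _)) h2)
    rw [← Finset.add_sum_erase S _ hu]
    have h1 : ∀ x ∈ S.erase u, #{y ∈ S | G.Adj x y} =
        #{y ∈ S.erase u | G.Adj x y} + if G.Adj u x then 1 else 0 := by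
      intro x hx
      conv_lhs => rw [← Finset.insert_erase hu, Finset.filter_insert]
      by_cases h : G.Adj u x
      · rw [if_pos h.symm, if_pos h, Finset.card_insert_of_notMem (by simp)]
      · rw [if_neg (fun h' => h h'.symm), if_neg h]; rfl
    rw [Finset.sum_congr rfl h1, Finset.sum_add_distrib, ← Finset.card_filter]
    have h2 : #{x ∈ S.erase u | G.Adj u x} ≤ #{x ∈ S | G.Adj u x} :=
      Finset.card_le_card (Finset.filter_subset_filter _ (Finset.erase_subset _ _))
    nlinarith

lemma cliqueLt {V : Type*} [Fintype V] [DecidableEq V] (G : SimpleGraph V) [DecidableRel G.Adj]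
    (k : ℕ) (hk : 4 ≤ k)
    (hCk : ∀ (v : V) (w : G.Walk v v), w.IsCycle → w.length ≠ k) : G.cliqueNum < k := by
  by_contra! hcon
  obtain ⟨s, hs⟩ := G.exists_isNClique_cliqueNum
  obtain ⟨t, hts, ht⟩ := Finset.exists_subset_card_eq (s := s) (n := k) (by rw [hs.card_eq]; exact hcon)
  have hcl : ∀ a ∈ t, ∀ b ∈ t, a ≠ b → G.Adj a b :=
    fun a ha b hb hab => hs.isClique (hts ha) (hts hb) hab
  obtain ⟨v, hv⟩ : t.Nonempty := by rw [← Finset.card_pos]; omega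
  have hc : #(t.erase v) = k - 1 := by rw [Finset.card_erase_of_mem hv]; omega
  obtain ⟨u, hu, h⟩ := deg1 G k hk hCk v (t.erase v) (by rw [← Finset.card_pos]; omega)
    (fun x hx => hcl v hv x (Finset.mem_of_mem_erase hx) (Finset.ne_of_mem_erase hx).symm)
  have : ({x ∈ t.erase v | G.Adj u x} : Finset V) = (t.erase v).erase u := by
    ext x
    simp only [Finset.mem_filter, Finset.mem_erase] at hu ⊢
    constructor
    · rintro ⟨⟨h1, h2⟩, h3⟩; exact ⟨h3.ne', h1, h2⟩
    · rintro ⟨h1, h2, h3⟩; exact ⟨⟨h2, h3⟩, hcl u hu.2 x h3 h1.symm⟩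
  rw [this, Finset.card_erase_of_mem hu] at h
  omega

/-- number of closed 3-walks -/
def T3 {V : Type*} [Fintype V] [DecidableEq V] (G : SimpleGraph V) [DecidableRel G.Adj] : ℕ :=
  ∑ v, ∑ u ∈ G.neighborFinset v, #{x ∈ G.neighborFinset v | G.Adj u x}

lemma T3_le {V : Type*} [Fintype V] [DecidableEq V] (G : SimpleGraph V) [DecidableRel G.Adj] (c : ℕ)
    (h : ∀ v, ∑ u ∈ G.neighborFinset v, #{x ∈ G.neighborFinset v | G.Adj u x} ≤ c * G.degree v) :
    T3 G ≤ c * (2 * #G.edgeFinset) := by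
  rw [← G.sum_degrees_eq_twice_card_edges, Finset.mul_sum]
  exact Finset.sum_le_sum fun v _ => h v

lemma T3_deg1 {V : Type*} [Fintype V] [DecidableEq V] (G : SimpleGraph V) [DecidableRel G.Adj]
    (k : ℕ) (hk : 4 ≤ k)
    (hCk : ∀ (v : V) (w : G.Walk v v), w.IsCycle → w.length ≠ k) :
    T3 G ≤ (2 * (k - 3)) * (2 * #G.edgeFinset) := by
  refine T3_le G _ fun v => ?_
  exact degen G (k - 3) _ _ rfl fun S' h1 h2 => deg1 G k hk hCk v S' h2
    (fun x hx => by simpa using h1 hx)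

lemma T3_deg2 {V : Type*} [Fintype V] [DecidableEq V] (G : SimpleGraph V) [DecidableRel G.Adj]
    (k : ℕ) (hk : 4 ≤ k)
    (hCk : ∀ (v : V) (w : G.Walk v v), w.IsCycle → w.length ≠ k) (hw : G.cliqueNum = 3) :
    T3 G ≤ (2 * ((k - 2) / 2)) * (2 * #G.edgeFinset) := by
  refine T3_le G _ fun v => ?_
  refine degen G ((k - 2) / 2) _ _ rfl fun S' h1 h2 => deg2 G k hk hCk v ?_ S' h2
    (fun x hx => by simpa using h1 hx)
  intro a b c va vb vc ab ac bc
  have : G.IsNClique 4 {v, a, b, c} := by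
    refine ⟨?_, ?_⟩
    · simp [va, vb, vc, ab, ac, bc, SimpleGraph.isClique_iff, Set.pairwise_insert, va.symm, vb.symm,
        vc.symm, ab.symm, ac.symm, bc.symm]
    · simp [va.ne, vb.ne, vc.ne, ab.ne, ac.ne, bc.ne]
  have h := this.isClique.card_le_cliqueNum
  rw [this.card_eq] at h
  omega

lemma T3_four {V : Type*} [Fintype V] [DecidableEq V] (G : SimpleGraph V) [DecidableRel G.Adj]
    (hCk : ∀ (v : V) (w : G.Walk v v), w.IsCycle → w.length ≠ 4) :
    T3 G ≤ 1 * (2 * #G.edgeFinset) := by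
  refine T3_le G _ fun v => ?_
  rw [one_mul, ← G.card_neighborFinset_eq_degree, Finset.card_eq_sum_ones]
  refine Finset.sum_le_sum fun u hu => ?_
  by_contra! h
  obtain ⟨a, ha, b, hb, hab⟩ := Finset.one_lt_card.1 h
  simp only [Finset.mem_filter, mem_neighborFinset] at ha hb hu
  refine noPath G 4 le_rfl hCk v (Walk.cons ha.2.symm (Walk.cons hb.2 Walk.nil)) ?_ ?_ (by simp)
  · simp [Walk.cons_isPath_iff, ha.2.ne', hb.2.ne, hab]
  · simp [ha.1, hb.1, hu]

lemma T3_two {V : Type*} [Fintype V] [DecidableEq V] (G : SimpleGraph V) [DecidableRel G.Adj]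
    (hw : G.cliqueNum ≤ 2) : T3 G ≤ 0 * (2 * #G.edgeFinset) := by
  refine T3_le G _ fun v => ?_
  rw [zero_mul, Nat.le_zero, Finset.sum_eq_zero_iff]
  intro u hu
  rw [Finset.card_eq_zero, Finset.filter_eq_empty_iff]
  intro x hx hux
  simp only [mem_neighborFinset] at hu hx
  have : G.IsNClique 3 {v, u, x} := by
    rw [is3Clique_iff]
    exact ⟨v, u, x, hu, hx, hux, rfl⟩
  have h := this.isClique.card_le_cliqueNum
  rw [this.card_eq] at h
  omega

lemma trace3 {V : Type*} [Fintype V] [DecidableEq V] (G : SimpleGraph V) [DecidableRel G.Adj] :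
    ((G.adjMatrix ℝ) ^ 3).trace = T3 G := by
  simp only [pow_succ, pow_zero, one_mul, Matrix.trace, Matrix.diag, T3, Nat.cast_sum]
  refine Finset.sum_congr rfl fun v _ => ?_
  rw [mul_adjMatrix_apply]
  refine Finset.sum_congr rfl fun u hu => ?_
  rw [mul_adjMatrix_apply]
  simp only [adjMatrix_apply, Finset.sum_boole]
  congr 2
  ext x
  simp [and_comm]

lemma trace2 {V : Type*} [Fintype V] [DecidableEq V] (G : SimpleGraph V) [DecidableRel G.Adj] :
    ((G.adjMatrix ℝ) ^ 2).trace = 2 * (#G.edgeFinset : ℝ) := by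
  simp only [pow_two, Matrix.trace, Matrix.diag, adjMatrix_mul_self_apply_self]
  exact_mod_cast G.sum_degrees_eq_twice_card_edges

lemma trace_nonneg {V : Type*} [Fintype V] [DecidableEq V] (G : SimpleGraph V) [DecidableRel G.Adj]
    (n : ℕ) : 0 ≤ ((G.adjMatrix ℝ) ^ n).trace := by
  refine Finset.sum_nonneg fun v _ => ?_
  rw [Matrix.diag_apply, adjMatrix_pow_apply_eq_card_walk]
  positivity

lemma trace_pow_eq {V : Type*} [Fintype V] [DecidableEq V] {A : Matrix V V ℝ} (hA : A.IsHermitian)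
    (n : ℕ) : (A ^ n).trace = ∑ v, hA.eigenvalues v ^ n := by
  conv_lhs => rw [hA.spectral_theorem, ← map_pow, Unitary.conjStarAlgAut_apply,
    Matrix.trace_mul_comm, ← mul_assoc]
  simp [Matrix.diagonal_pow, Matrix.trace_diagonal]

lemma perron {ι : Type*} [Fintype ι] [DecidableEq ι] (μ : ι → ℝ) (h : ∀ p : ℕ, 0 ≤ ∑ i, μ i ^ p)
    (t : ℝ) (ht : 0 ≤ t) (hle : ∀ i, μ i ≤ t) (j : ι) : |μ j| ≤ t := by
  rw [abs_le]
  refine ⟨?_, hle j⟩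
  by_contra! hj
  set y := -μ j with hy
  have hy0 : 0 < y := by linarith
  have hyt : t < y := by linarith
  have hr1 : t / y < 1 := by rw [div_lt_one hy0]; exact hyt
  have hr0 : 0 ≤ t / y := by positivity
  have hc0 : (0 : ℝ) < (Fintype.card ι : ℝ) + 1 := by positivity
  obtain ⟨n, hn⟩ := exists_pow_lt_of_lt_one (inv_pos.2 hc0) hr1
  have hodd : Odd (2 * n + 1) := ⟨n, rfl⟩
  have h1 : (t / y) ^ (2 * n + 1) ≤ (t / y) ^ n :=
    pow_le_pow_of_le_one hr0 hr1.le (by omega)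
  have h2 := h (2 * n + 1)
  rw [← Finset.add_sum_erase _ _ (Finset.mem_univ j)] at h2
  have h3 : ∑ i ∈ Finset.univ.erase j, μ i ^ (2 * n + 1) ≤
      ∑ i ∈ (Finset.univ : Finset ι).erase j, t ^ (2 * n + 1) :=
    Finset.sum_le_sum fun i _ => hodd.strictMono_pow.monotone (hle i)
  have h4 : ∑ i ∈ (Finset.univ : Finset ι).erase j, t ^ (2 * n + 1) ≤
      (Fintype.card ι : ℝ) * t ^ (2 * n + 1) := by
    rw [Finset.sum_const, nsmul_eq_mul]
    gcongr
    exact Finset.card_le_univ _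
  have h5 : μ j ^ (2 * n + 1) = - y ^ (2 * n + 1) := by
    rw [hy, hodd.neg_pow]; ring
  have hyp : 0 < y ^ (2 * n + 1) := by positivity
  have h6 : y ^ (2 * n + 1) ≤ (Fintype.card ι : ℝ) * t ^ (2 * n + 1) := by linarith
  have h7 : (t / y) ^ (2 * n + 1) < ((Fintype.card ι : ℝ) + 1)⁻¹ := lt_of_le_of_lt h1 hn
  rw [div_pow, div_lt_iff₀ hyp, inv_mul_eq_div, lt_div_iff₀ hc0] at h7
  have : 0 ≤ t ^ (2 * n + 1) := by positivity
  nlinarith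

lemma cube_le {ι : Type*} (J : Finset ι) (f : ι → ℝ) (hf : ∀ i ∈ J, 0 ≤ f i) (q : ℝ) (hq : 0 ≤ q)
    (h : ∑ i ∈ J, f i ^ 2 ≤ q ^ 2) : ∑ i ∈ J, f i ^ 3 ≤ q ^ 3 := by
  have h1 : ∀ i ∈ J, f i ^ 3 ≤ q * f i ^ 2 := by
    intro i hi
    have h2 : f i ^ 2 ≤ ∑ i ∈ J, f i ^ 2 :=
      Finset.single_le_sum (f := fun i => f i ^ 2) (fun i _ => sq_nonneg _) hi
    have h3 : f i ≤ q := abs_le_of_sq_le_sq' (h2.trans h) hq |>.2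
    nlinarith [sq_nonneg (f i)]
  calc _ ≤ ∑ i ∈ J, q * f i ^ 2 := Finset.sum_le_sum h1
    _ = q * ∑ i ∈ J, f i ^ 2 := by rw [Finset.mul_sum]
    _ ≤ q * q ^ 2 := by gcongr
    _ = q ^ 3 := by ring

lemma two_cube (s t y z : ℝ) (hs : 0 ≤ s) (hy : s ≤ y) (hyt : y ≤ t) (hz : 0 ≤ z)
    (h : y ^ 2 + z ^ 2 ≤ t ^ 2 + s ^ 2) : y ^ 3 + z ^ 3 ≤ t ^ 3 + s ^ 3 := by
  have aux : ∀ y z : ℝ, s ≤ z → z ≤ y → y ≤ t → y ^ 2 + z ^ 2 ≤ t ^ 2 + s ^ 2 →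
      y ^ 3 + z ^ 3 ≤ t ^ 3 + s ^ 3 := by
    intro y z hz hzy hyt h
    have h1 : 3 * y * (t ^ 2 - y ^ 2) ≤ 2 * (t ^ 3 - y ^ 3) := by
      nlinarith [mul_nonneg (sq_nonneg (t - y)) (by linarith : 0 ≤ 2 * t + y)]
    have h2 : 2 * (z ^ 3 - s ^ 3) ≤ 3 * z * (z ^ 2 - s ^ 2) := by
      nlinarith [mul_nonneg (sq_nonneg (z - s)) (by linarith : 0 ≤ z + 2 * s)]
    have h3 : 3 * z * (z ^ 2 - s ^ 2) ≤ 3 * y * (z ^ 2 - s ^ 2) := by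
      have : 0 ≤ z ^ 2 - s ^ 2 := by nlinarith
      nlinarith
    have h4 : 3 * y * (z ^ 2 - s ^ 2) ≤ 3 * y * (t ^ 2 - y ^ 2) := by
      have : 0 ≤ y := by linarith
      nlinarith
    linarith
  rcases le_total z s with hzs | hzs
  · have := pow_le_pow_left₀ hz hzs 3
    have := pow_le_pow_left₀ (hs.trans hy) hyt 3
    linarith
  · rcases le_total z y with hzy | hzy
    · exact aux y z hzs hzy hyt h
    · have hzt : z ≤ t := by
        have : z ^ 2 ≤ t ^ 2 := by nlinarith
        exact abs_le_of_sq_le_sq' this (by linarith) |>.2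
      have := aux z y hy hzy hzt (by linarith)
      linarith

lemma two_case {ι : Type*} [DecidableEq ι] (J : Finset ι) (f : ι → ℝ) (s t : ℝ) (hs : 0 ≤ s)
    (hst : s ≤ t) (ht : 0 < t) (hf : ∀ i ∈ J, 0 ≤ f i) (hft : ∀ i ∈ J, f i ≤ t)
    (h : ∑ i ∈ J, f i ^ 2 < t ^ 2 + s ^ 2) : ∑ i ∈ J, f i ^ 3 < t ^ 3 + s ^ 3 := by
  by_cases hall : ∀ i ∈ J, f i ≤ s
  · have h1 : ∑ i ∈ J, f i ^ 3 ≤ s * ∑ i ∈ J, f i ^ 2 := by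
      rw [Finset.mul_sum]
      refine Finset.sum_le_sum fun i hi => ?_
      nlinarith [hall i hi, sq_nonneg (f i)]
    rcases hs.eq_or_lt with rfl | hs
    · have : 0 < t ^ 3 := by positivity
      linarith
    · have : s * ∑ i ∈ J, f i ^ 2 < s * (t ^ 2 + s ^ 2) := by gcongr
      nlinarith [sq_nonneg t]
  · push Not at hall
    obtain ⟨j, hj, hsj⟩ := hall
    rw [← Finset.add_sum_erase _ _ hj] at h ⊢
    have hR : 0 ≤ ∑ i ∈ J.erase j, f i ^ 2 := Finset.sum_nonneg fun i _ => sq_nonneg _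
    set R := ∑ i ∈ J.erase j, f i ^ 2 with hRdef
    have hz0 : 0 ≤ t ^ 2 + s ^ 2 - f j ^ 2 := by linarith
    have h1 := two_cube s t (f j) √(t ^ 2 + s ^ 2 - f j ^ 2) hs hsj.le (hft j hj)
      (Real.sqrt_nonneg _) (by rw [Real.sq_sqrt hz0]; linarith)
    have h2 := cube_le (J.erase j) f (fun i hi => hf i (Finset.mem_of_mem_erase hi)) √R
      (Real.sqrt_nonneg _) (by rw [Real.sq_sqrt hR])
    have h3 : √R < √(t ^ 2 + s ^ 2 - f j ^ 2) := Real.sqrt_lt_sqrt hR (by linarith)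
    have h4 : √R ^ 3 < √(t ^ 2 + s ^ 2 - f j ^ 2) ^ 3 :=
      pow_lt_pow_left₀ h3 (Real.sqrt_nonneg _) (by norm_num)
    linarith

lemma split3 {ι : Type*} [Fintype ι] [DecidableEq ι] (μ : ι → ℝ) (I : Finset ι) :
    ∑ i ∈ I, μ i ^ 3 - ∑ i ∈ Iᶜ, |μ i| ^ 3 ≤ ∑ i, μ i ^ 3 := by
  rw [← Finset.sum_add_sum_compl I]
  have : ∑ i ∈ Iᶜ, -(|μ i| ^ 3) ≤ ∑ i ∈ Iᶜ, μ i ^ 3 := by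
    refine Finset.sum_le_sum fun i _ => ?_
    rw [← abs_pow]
    exact neg_abs_le _
  rw [Finset.sum_neg_distrib] at this
  linarith

lemma final_two {ι : Type*} [Fintype ι] [DecidableEq ι] (μ : ι → ℝ) (I : Finset ι)
    (hpos : ∀ i ∈ I, 0 < μ i) (hI : I.card ≤ 2) (h : ∀ p : ℕ, 0 ≤ ∑ i, μ i ^ p)
    (htop : I.Nonempty → ∃ i ∈ I, ∀ j, μ j ≤ μ i) (hT : ∑ i, μ i ^ 3 ≤ 0) :
    ∑ i ∈ I, μ i ^ 2 ≤ (∑ i, μ i ^ 2) / 2 := by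
  by_contra! hcon
  have hne : I.Nonempty := by
    rw [Finset.nonempty_iff_ne_empty]
    rintro rfl
    have := h 2
    simp at hcon
    linarith
  obtain ⟨i, hi, hmax⟩ := htop hne
  have hp := perron μ h (μ i) (hpos i hi).le hmax
  have key : ∃ s, 0 ≤ s ∧ s ≤ μ i ∧ ∑ j ∈ I, μ j ^ 2 = μ i ^ 2 + s ^ 2 ∧
      ∑ j ∈ I, μ j ^ 3 = μ i ^ 3 + s ^ 3 := by
    have hc : (I.erase i).card ≤ 1 := by rw [Finset.card_erase_of_mem hi]; omega
    rw [← Finset.add_sum_erase _ _ hi, ← Finset.add_sum_erase _ _ hi]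
    rcases Nat.le_one_iff_eq_zero_or_eq_one.1 hc with h0 | h1
    · rw [Finset.card_eq_zero] at h0
      exact ⟨0, le_rfl, (hpos i hi).le, by simp [h0], by simp [h0]⟩
    · obtain ⟨a, ha⟩ := Finset.card_eq_one.1 h1
      have haI : a ∈ I := Finset.mem_of_mem_erase (ha ▸ Finset.mem_singleton_self a : a ∈ I.erase i)
      exact ⟨μ a, (hpos a haI).le, hmax a, by simp [ha], by simp [ha]⟩
  obtain ⟨s, hs, hst, h2, h3⟩ := key
  have hR := Finset.sum_add_sum_compl I (fun i => μ i ^ 2)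
  have := two_case Iᶜ (fun i => |μ i|) s (μ i) hs hst (hpos i hi) (fun _ _ => abs_nonneg _)
    (fun j _ => hp j) (by simp only [sq_abs]; linarith)
  have := split3 μ I
  linarith

lemma final_big {ι : Type*} [Fintype ι] [DecidableEq ι] (μ : ι → ℝ) (I : Finset ι)
    (hpos : ∀ i ∈ I, 0 < μ i) (w : ℝ) (hw : 1 ≤ w) (hI : (I.card : ℝ) ≤ w) (M : ℝ) (hM : 0 < M)
    (hM2 : ∑ i, μ i ^ 2 = M) (c : ℝ) (hc : ∑ i, μ i ^ 3 ≤ c * M) (a b : ℝ)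
    (ha : 0 ≤ a) (ha2 : a ^ 2 ≤ (1 - 1 / w) ^ 3) (hb : 1 / w ≤ b) (hab : b ≤ a)
    (hS : M * (1 - 1 / w) < ∑ i ∈ I, μ i ^ 2) : M * (a - b) ^ 2 ≤ w * c ^ 2 := by
  have hw0 : 0 < w := by linarith
  have h1w : 0 ≤ 1 - 1 / w := by
    have : 1 / w ≤ 1 := by rw [div_le_one hw0]; exact hw
    linarith
  set S := ∑ i ∈ I, μ i ^ 2 with hSd
  set C := ∑ i ∈ I, μ i ^ 3 with hCd
  have hS0 : 0 < S := lt_of_le_of_lt (by positivity) hS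
  have hC0 : 0 ≤ C := Finset.sum_nonneg fun i hi => by have := hpos i hi; positivity
  have hSC : S ^ 3 ≤ w * C ^ 2 := by
    have e1 : S ^ 2 ≤ (∑ i ∈ I, μ i) * C :=
      Finset.sum_sq_le_sum_mul_sum_of_sq_eq_mul I (fun i hi => (hpos i hi).le)
        (fun i hi => by have := hpos i hi; positivity) (fun i hi => by ring)
    have e2 : (∑ i ∈ I, μ i) ^ 2 ≤ I.card * S := sq_sum_le_card_mul_sum_sq
    have e3 : (∑ i ∈ I, μ i) ^ 2 ≤ w * S := e2.trans (by gcongr)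
    have e4 : (S ^ 2) ^ 2 ≤ ((∑ i ∈ I, μ i) * C) ^ 2 := by gcongr
    have e5 : ((∑ i ∈ I, μ i) * C) ^ 2 ≤ w * S * C ^ 2 := by rw [mul_pow]; gcongr
    have e6 : S * S ^ 3 ≤ S * (w * C ^ 2) := by nlinarith
    exact le_of_mul_le_mul_left e6 hS0
  obtain ⟨x, hx, rfl⟩ : ∃ x : ℝ, 0 < x ∧ x ^ 2 = M := ⟨√M, by positivity, Real.sq_sqrt hM.le⟩
  obtain ⟨r, hr, rfl⟩ : ∃ x : ℝ, 0 < x ∧ x ^ 2 = w := ⟨√w, by positivity, Real.sq_sqrt hw0.le⟩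
  have hC1 : x ^ 3 * a ≤ r * C := by
    refine abs_le_of_sq_le_sq' ?_ (by positivity) |>.2
    calc (x ^ 3 * a) ^ 2 = (x ^ 2) ^ 3 * a ^ 2 := by ring
      _ ≤ (x ^ 2) ^ 3 * (1 - 1 / r ^ 2) ^ 3 := by gcongr
      _ = (x ^ 2 * (1 - 1 / r ^ 2)) ^ 3 := by ring
      _ ≤ S ^ 3 := by gcongr
      _ ≤ _ := hSC
      _ = _ := by ring
  have hR := Finset.sum_add_sum_compl I (fun i => μ i ^ 2)
  have hQ := cube_le Iᶜ (fun i => |μ i|) (fun _ _ => abs_nonneg _) (x / r) (by positivity) (by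
    simp only [sq_abs]
    have : (x / r) ^ 2 = x ^ 2 - x ^ 2 * (1 - 1 / r ^ 2) := by field_simp; ring
    rw [this]
    linarith)
  have hQ1 : r * ∑ i ∈ Iᶜ, |μ i| ^ 3 ≤ x ^ 3 * b := by
    calc r * ∑ i ∈ Iᶜ, |μ i| ^ 3 ≤ r * (x / r) ^ 3 := by gcongr
      _ = x ^ 3 * (1 / r ^ 2) := by field_simp
      _ ≤ _ := by gcongr
  have h3 := split3 μ I
  have h4 : x ^ 3 * (a - b) ≤ r * (c * x ^ 2) := by
    have : r * (C - ∑ i ∈ Iᶜ, |μ i| ^ 3) ≤ r * (c * x ^ 2) := by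
      gcongr; linarith
    nlinarith
  have h5 : x * (a - b) ≤ r * c := by
    have : x ^ 2 * (x * (a - b)) ≤ x ^ 2 * (r * c) := by nlinarith
    exact le_of_mul_le_mul_left this (by positivity)
  have h6 : 0 ≤ x * (a - b) := mul_nonneg hx.le (by linarith)
  calc x ^ 2 * (a - b) ^ 2 = (x * (a - b)) ^ 2 := by ring
    _ ≤ (r * c) ^ 2 := by gcongr
    _ = _ := by ring

lemma numer (k w c M a b : ℝ) (hM : 2 * (10.06 * (k - 3) * √k / 3) ^ 2 ≤ M) (hk : 0 ≤ k)
    (h : M * (a - b) ^ 2 ≤ w * c ^ 2) :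
    2 * (10.06 / 3) ^ 2 * (k - 3) ^ 2 * k * (a - b) ^ 2 ≤ w * c ^ 2 := by
  refine le_trans ?_ h
  refine le_trans (le_of_eq ?_) (mul_le_mul_of_nonneg_right hM (sq_nonneg _))
  have := Real.sq_sqrt hk
  have e : (10.06 * (k - 3) * √k / 3) ^ 2 = (10.06 / 3) ^ 2 * (k - 3) ^ 2 * √k ^ 2 := by ring
  rw [e, this]; ring

end S8

/-- **Corollary (cycle-free graphs).** Let `k ≥ 4` and let `G` be `C_k`-free, i.e. `G`
contains no cycle of length `k`. If the number of edges `m` satisfies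
`m ≥ (10.06·(k−3)·√k/3)²`, then `s_ℓ(G) ≤ 2m(1 − 1/ω(G))` where `ℓ = min{n⁺, ω(G)}`,
`n⁺` is the number of positive eigenvalues, and `s_ℓ` is the sum of squares of the `ℓ`
largest eigenvalues `μ 0 ≥ μ 1 ≥ ⋯`. -/
theorem stmt_8 {V : Type*} [Fintype V] [DecidableEq V]
    (G : SimpleGraph V) [DecidableRel G.Adj]
    (k : ℕ) (hk : 4 ≤ k)
    (hCk : ∀ (v : V) (w : G.Walk v v), w.IsCycle → w.length ≠ k)
    (m : ℕ) (hm : G.edgeFinset.card = m)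
    (hedges : (10.06 * ((k : ℝ) - 3) * Real.sqrt (k : ℝ) / 3) ^ 2 ≤ (m : ℝ))
    (μ : Fin (Fintype.card V) → ℝ) (hanti : Antitone μ)
    (hμ : ∃ e : V ≃ Fin (Fintype.card V),
      ∀ v, (adjMatrix_isHermitian G).eigenvalues v = μ (e v)) :
    (∑ i ∈ Finset.univ.filter
        (fun i : Fin (Fintype.card V) =>
          (i : ℕ) < min ((Finset.univ.filter fun j => 0 < μ j).card) G.cliqueNum),
        μ i ^ 2)
      ≤ 2 * (m : ℝ) * (1 - 1 / (G.cliqueNum : ℝ)) := by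
  classical
  obtain ⟨e, he⟩ := hμ
  have hkR : (4 : ℝ) ≤ k := by exact_mod_cast hk
  have htr : ∀ p : ℕ, ∑ i, μ i ^ p = ((G.adjMatrix ℝ) ^ p).trace := by
    intro p
    rw [S8.trace_pow_eq (adjMatrix_isHermitian G), ← e.sum_comp]
    exact Finset.sum_congr rfl fun v _ => by rw [he v]
  have hnn : ∀ p : ℕ, 0 ≤ ∑ i, μ i ^ p := fun p => by rw [htr]; exact S8.trace_nonneg G p
  have hM2 : ∑ i, μ i ^ 2 = 2 * (m : ℝ) := by rw [htr, S8.trace2, hm]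
  have hT3 : ∑ i, μ i ^ 3 = S8.T3 G := by rw [htr, S8.trace3]
  have hm0 : (0 : ℝ) < m := by
    refine lt_of_lt_of_le ?_ hedges
    have : 0 < √(k : ℝ) := Real.sqrt_pos.2 (by linarith)
    have : 0 < (k : ℝ) - 3 := by linarith
    positivity
  have hwk := S8.cliqueLt G k hk hCk
  have hw2 : 2 ≤ G.cliqueNum := by
    have : G.edgeFinset.Nonempty := by
      rw [← Finset.card_pos, hm]; exact_mod_cast hm0
    obtain ⟨x, hx⟩ := this
    induction x with
    | _ a b =>
    rw [SimpleGraph.mem_edgeFinset, SimpleGraph.mem_edgeSet] at hx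
    have h2 : G.IsClique (({a, b} : Finset V) : Set V) := by
      simp [SimpleGraph.isClique_iff, Set.pairwise_insert, hx, hx.symm]
    have := h2.card_le_cliqueNum
    rwa [Finset.card_pair hx.ne] at this
  set ω := G.cliqueNum with hω
  set P := (Finset.univ.filter fun j => 0 < μ j) with hP
  set I := Finset.univ.filter
        (fun i : Fin (Fintype.card V) => (i : ℕ) < min P.card ω) with hI
  have hIpos : ∀ i ∈ I, 0 < μ i := by
    intro i hi
    rw [hI, Finset.mem_filter, lt_min_iff] at hi
    by_contra! hneg
    have hsub : P ⊆ Finset.Iio i := by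
      intro j hj
      rw [hP, Finset.mem_filter] at hj
      rw [Finset.mem_Iio]
      by_contra! hij
      have := hanti hij
      linarith [hj.2]
    have := Finset.card_le_card hsub
    rw [Fin.card_Iio] at this
    omega
  have hIcard : I.card ≤ ω := by
    have : I.card = (I.image (fun i : Fin (Fintype.card V) => (i : ℕ))).card :=
      (Finset.card_image_of_injective _ Fin.val_injective).symm
    rw [this]
    refine (Finset.card_le_card (t := Finset.range ω) ?_).trans (by simp)
    intro x hx
    simp only [hI, Finset.mem_image, Finset.mem_filter, lt_min_iff] at hx
    obtain ⟨i, hi, rfl⟩ := hx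
    simpa using hi.2.2
  have htop : I.Nonempty → ∃ i ∈ I, ∀ j, μ j ≤ μ i := by
    rintro ⟨i, hi⟩
    have hi0 := i.isLt
    refine ⟨⟨0, by omega⟩, ?_, fun j => hanti (by simp [Fin.le_def])⟩
    rw [hI, Finset.mem_filter] at hi ⊢
    exact ⟨Finset.mem_univ _, lt_of_le_of_lt (Nat.zero_le _) hi.2⟩
  have hedges2 : 2 * (10.06 * ((k : ℝ) - 3) * √(k : ℝ) / 3) ^ 2 ≤ 2 * (m : ℝ) := by linarith
  have hwR : (2 : ℝ) ≤ ω := by exact_mod_cast hw2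
  have hwkR : (ω : ℝ) + 1 ≤ k := by exact_mod_cast hwk
  by_contra! hcon
  have main : ∀ (c : ℕ) (a b : ℝ), S8.T3 G ≤ c * (2 * G.edgeFinset.card) → 0 ≤ a →
      a ^ 2 ≤ (1 - 1 / (ω : ℝ)) ^ 3 → 1 / (ω : ℝ) ≤ b → b ≤ a →
      2 * (10.06 / 3) ^ 2 * ((k : ℝ) - 3) ^ 2 * k * (a - b) ^ 2 ≤ ω * (c : ℝ) ^ 2 := by
    intro c a b hc ha ha2 hb hab
    refine S8.numer k ω c (2 * m) a b hedges2 (by linarith) ?_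
    refine S8.final_big μ I hIpos ω (by linarith) (by exact_mod_cast hIcard) (2 * m)
      (by linarith) hM2 c ?_ a b ha ha2 hb hab hcon
    rw [hT3, ← hm]
    exact_mod_cast hc
  rcases (by omega : ω = 2 ∨ ω = 3 ∨ ω = 4 ∨ 5 ≤ ω) with h2 | h3 | h4 | h5
  · have ht := S8.T3_two G (by omega)
    have := S8.final_two μ I hIpos (by omega) hnn htop
      (by rw [hT3]; exact_mod_cast (by simpa using ht : S8.T3 G = 0).le)
    rw [h2] at hcon
    norm_num at hcon
    linarith
  · have main3 : ∀ c : ℕ, S8.T3 G ≤ c * (2 * G.edgeFinset.card) →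
        ((k : ℝ) - 3) ^ 2 * k ≤ 3 * (c : ℝ) ^ 2 := by
      intro c hc
      have := main c 0.5443 0.33334 hc (by norm_num) (by rw [h3]; norm_num) (by rw [h3]; norm_num)
        (by norm_num)
      rw [h3] at this
      have hp : 0 ≤ ((k : ℝ) - 3) ^ 2 * k := by positivity
      norm_num at this ⊢
      nlinarith
    rcases (by omega : k = 4 ∨ k = 5 ∨ k = 6 ∨ 7 ≤ k) with h | h | h | h
    · subst h
      have := main3 1 (S8.T3_four G hCk)
      norm_num at this
    · subst h
      have := main3 _ (S8.T3_deg2 G 5 hk hCk h3)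
      norm_num at this
    · subst h
      have := main3 _ (S8.T3_deg2 G 6 hk hCk h3)
      norm_num at this
    · have h7 : (7 : ℝ) ≤ k := by exact_mod_cast h
      have := main3 (k - 2) ((S8.T3_deg2 G k hk hCk h3).trans
        (Nat.mul_le_mul_right _ (by omega)))
      rw [Nat.cast_sub (by omega)] at this
      push_cast at this
      nlinarith [sq_nonneg ((k : ℝ) - 3)]
  · have := main _ 0.6495 0.25 (S8.T3_deg1 G k hk hCk) (by norm_num) (by rw [h4]; norm_num)
      (by rw [h4]; norm_num) (by norm_num)
    rw [h4] at this hwkR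
    push_cast [Nat.cast_sub (by omega : 3 ≤ k)] at this
    have hp : 0 < ((k : ℝ) - 3) ^ 2 := pow_pos (by linarith) 2
    have : ((k : ℝ) - 3) ^ 2 * (3.58 * k) ≤ ((k : ℝ) - 3) ^ 2 * 16 := by
      norm_num at this ⊢
      nlinarith [mul_nonneg hp.le (by linarith : (0 : ℝ) ≤ k)]
    have := le_of_mul_le_mul_left this hp
    have h5k : (5 : ℝ) ≤ k := by exact_mod_cast (by omega : 5 ≤ k)
    norm_num at this
    linarith
  · have h5R : (5 : ℝ) ≤ ω := by exact_mod_cast h5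
    have hinv : 1 / (ω : ℝ) ≤ 0.2 := by
      rw [div_le_iff₀ (by linarith)]; linarith
    have := main _ 0.7155 0.2 (S8.T3_deg1 G k hk hCk) (by norm_num)
      (by
        calc (0.7155 : ℝ) ^ 2 ≤ 0.8 ^ 3 := by norm_num
          _ ≤ _ := by gcongr; linarith)
      hinv (by norm_num)
    push_cast [Nat.cast_sub (by omega : 3 ≤ k)] at this
    have hp : 0 < ((k : ℝ) - 3) ^ 2 := pow_pos (by linarith) 2
    have : ((k : ℝ) - 3) ^ 2 * (4 * k) ≤ ((k : ℝ) - 3) ^ 2 * (4 * ω) := by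
      norm_num at this ⊢
      nlinarith [mul_nonneg hp.le (by linarith : (0 : ℝ) ≤ k)]
    have := le_of_mul_le_mul_left this hp
    linarith
end

section
/- Let k ≥ 3 be an integer and let G be a finite simple graph with m edges that is C_k-free, i.e., G contains no cycle of length k as a subgraph. Then t(G) ≤ (k−3)·m/3. -/
open Finset in
lemma aux_count {V : Type*} (P Q : V → Prop) [DecidablePred P] [DecidablePred Q] :
    ∀ (l : List V) (x : V),
      (∃ s a b t, x :: l = s ++ a :: b :: t ∧ Q a ∧ P b) ∨
      l.countP P + (x :: l).dropLast.countP Q ≤ l.length := by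
  intro l
  induction l with
  | nil => intro x; right; simp
  | cons y l ih =>
    intro x
    by_cases h : Q x ∧ P y
    · left; exact ⟨[], x, y, l, rfl, h⟩
    · rcases ih y with ⟨s, a, b, t, h1, h2⟩ | h1
      · left; exact ⟨x :: s, a, b, t, by rw [h1]; rfl, h2⟩
      · right
        simp only [List.dropLast_cons_cons, List.countP_cons, List.length_cons, decide_eq_true_eq] at h1 ⊢
        by_cases hq : Q x <;> by_cases hp : P y <;> simp_all <;> omega

lemma aux_card_le {V : Type*} [DecidableEq V] (A : Finset V) (P : V → Prop) [DecidablePred P]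
    (p : List V) (h : ∀ a ∈ A, P a → a ∈ p) : (A.filter P).card ≤ p.countP P := by
  rw [List.countP_eq_length_filter]
  refine le_trans (Finset.card_le_card ?_) (List.toFinset_card_le _)
  intro a ha
  simp at ha ⊢
  exact ⟨h a ha.1 ha.2, ha.2⟩

/-- rotating a cyclic list -/
lemma aux_rot {V : Type*} (G : SimpleGraph V) (c : List V) (hc : c.IsChain G.Adj)
    (hn : c.Nodup) (hcl : ∀ a ∈ c.getLast?, ∀ b ∈ c.head?, G.Adj a b)
    (y z : V) (hz : z ∈ c) (hy : y ∉ c) (hyz : G.Adj y z) :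
    ∃ q : List V, q.IsChain G.Adj ∧ q.Nodup ∧ q.length = c.length + 1 ∧
      ∀ a ∈ q, a = y ∨ a ∈ c := by
  obtain ⟨s, t, rfl⟩ := List.append_of_mem hz
  refine ⟨y :: ((z :: t) ++ s), ?_, ?_, ?_, ?_⟩
  · have h1 := List.isChain_append.1 hc
    have h2 : ((z :: t) ++ s).IsChain G.Adj := by
      rw [List.isChain_append]
      refine ⟨h1.2.1, h1.1, ?_⟩
      intro a ha b hb
      apply hcl a _ b
      · cases s <;> simp_all
      · rw [List.getLast?_append]; simp_all
    simpa using ⟨hyz, h2⟩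
  · rw [List.nodup_cons]
    refine ⟨?_, ?_⟩
    · simp at hy ⊢; tauto
    · exact List.nodup_append_comm.1 hn
  · simp; omega
  · intro a; simp; tauto

/-- Erdos-Gallai for paths, inside a vertex set `A` -/
lemma aux_EG {V : Type*} [DecidableEq V] (G : SimpleGraph V) [DecidableRel G.Adj] (L : ℕ)
    (hL : 1 ≤ L) : ∀ (n : ℕ) (A : Finset V), A.card = n →
    (∀ p : List V, p.IsChain G.Adj → p.Nodup → (∀ a ∈ p, a ∈ A) → p.length ≠ L + 1) →
    ∑ a ∈ A, (A.filter (G.Adj a)).card ≤ (L - 1) * A.card := by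
  intro n
  induction n using Nat.strong_induction_on with
  | _ n ih =>
  intro A hA hp
  rcases A.eq_empty_or_nonempty with rfl | hne
  · simp
  by_cases hdeg : ∃ v ∈ A, 2 * (A.filter (G.Adj v)).card ≤ L - 1
  · obtain ⟨v, hv, hd⟩ := hdeg
    have hc := Finset.card_erase_add_one hv
    have h1 := ih (A.erase v).card (by omega) (A.erase v) rfl
      (fun p h1 h2 h3 => hp p h1 h2 (fun a ha => Finset.mem_of_mem_erase (h3 a ha)))
    rw [← Finset.sum_erase_add _ _ hv]
    have h2 : ∀ a ∈ A.erase v, (A.filter (G.Adj a)).card =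
        ((A.erase v).filter (G.Adj a)).card + if G.Adj v a then 1 else 0 := by
      intro a ha
      rw [Finset.filter_erase]
      split_ifs with h
      · rw [Finset.card_erase_add_one]; simp [hv, h.symm]
      · rw [Finset.erase_eq_of_notMem]; rfl
        simp [G.adj_comm a v, h]
    rw [Finset.sum_congr rfl h2, Finset.sum_add_distrib, ← Finset.card_filter (G.Adj v)]
    have h3 : ((A.erase v).filter (G.Adj v)).card ≤ (A.filter (G.Adj v)).card :=
      Finset.card_le_card (Finset.filter_subset_filter _ (Finset.erase_subset _ _))
    rw [← hc, mul_add, mul_one]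
    refine le_trans (add_le_add_left (add_le_add h1 h3) _) ?_
    omega
  · push Not at hdeg
    -- all short
    have hshort : ∀ p : List V, p.IsChain G.Adj → p.Nodup → (∀ a ∈ p, a ∈ A) → p.length ≤ L := by
      intro p h1 h2 h3
      by_contra hlt
      refine hp (p.take (L + 1)) (h1.take _) (h2.sublist (List.take_sublist _ _))
        (fun a ha => h3 a (List.mem_of_mem_take ha)) ?_
      simp; omega
    -- longest path
    obtain ⟨p, hpne, hch, hnd, hpA, hmax⟩ : ∃ p : List V, p ≠ [] ∧ p.IsChain G.Adj ∧ p.Nodup ∧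
        (∀ a ∈ p, a ∈ A) ∧ ∀ q : List V, q.IsChain G.Adj → q.Nodup → (∀ a ∈ q, a ∈ A) →
          q.length ≤ p.length := by
      let S : Set ℕ := {i | ∃ p : List V, p.IsChain G.Adj ∧ p.Nodup ∧ (∀ a ∈ p, a ∈ A) ∧
        p.length = i}
      have hb : BddAbove S := ⟨L, by rintro _ ⟨p, h1, h2, h3, rfl⟩; exact hshort p h1 h2 h3⟩
      obtain ⟨v, hv⟩ := hne
      have h1 : 1 ∈ S := ⟨[v], by simp, by simp, by simpa using hv, rfl⟩
      obtain ⟨p, h2, h3, h4, h5⟩ := Nat.sSup_mem ⟨1, h1⟩ hb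
      have := le_csSup hb h1
      refine ⟨p, ?_, h2, h3, h4, ?_⟩
      · rintro rfl
        simp at h5; omega
      · intro q k1 k2 k3
        rw [h5]
        exact le_csSup hb ⟨q, k1, k2, k3, rfl⟩
    have hpL := hshort p hch hnd hpA
    obtain ⟨x, l, rfl⟩ := List.exists_cons_of_ne_nil hpne
    obtain ⟨l', z, hl'⟩ := List.eq_nil_or_concat' (x :: l) |>.resolve_left hpne
    have hxA : x ∈ A := hpA x (by simp)
    have hzA : z ∈ A := hpA z (by rw [hl']; simp)
    have hx : (A.filter (G.Adj x)).card ≤ l.countP (G.Adj x) := by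
      have := aux_card_le A (G.Adj x) (x :: l) ?_
      · simpa using this
      intro a ha hxa
      by_contra hn
      have := hmax (a :: x :: l) (by simpa using ⟨hxa.symm, hch⟩)
        (by rw [List.nodup_cons]; exact ⟨hn, hnd⟩)
        (by intro b hb; rcases List.mem_cons.1 hb with rfl | hb; exact ha; exact hpA b hb)
      simp at this
    have hz : (A.filter (G.Adj z)).card ≤ (x :: l).dropLast.countP (G.Adj z) := by
      have := aux_card_le A (G.Adj z) (x :: l) ?_
      · rw [hl'] at this ⊢; simpa [List.countP_append] using this
      intro a ha hxa
      by_contra hn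
      have := hmax ((x :: l) ++ [a]) 
        (by rw [List.isChain_append]; refine ⟨hch, by simp, ?_⟩; rw [hl']; simpa using hxa)
        (by rw [List.nodup_append]; refine ⟨hnd, by simp, ?_⟩; intro b hb c hc; 
            rintro rfl; simp at hc; subst hc; exact hn hb)
        (by intro b hb; rcases List.mem_append.1 hb with hb | hb; exact hpA b hb; 
            simp at hb; rwa [hb])
      simp at this
    have hdx := hdeg x hxA
    have hdz := hdeg z hzA
    rcases aux_count (G.Adj x) (G.Adj z) l x with ⟨s, a, b, t, h1, h2, h3⟩ | hcnt
    swap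
    · simp at hpL; omega
    -- the cycle
    have hcyc : ∃ c : List V, c.IsChain G.Adj ∧ c.Nodup ∧
        (∀ a ∈ c.getLast?, ∀ b ∈ c.head?, G.Adj a b) ∧ c.Perm (x :: l) := by
      refine ⟨(s ++ [a]) ++ (b :: t).reverse, ?_, ?_, ?_, ?_⟩
      · have e : x :: l = (s ++ [a]) ++ (b :: t) := by rw [h1]; simp
        have hch' := hch
        rw [e, List.isChain_append] at hch'
        rw [List.isChain_append]
        refine ⟨hch'.1, ?_, ?_⟩
        · rw [List.isChain_reverse]
          exact hch'.2.1.imp (fun _ _ h => h.symm)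
        · have hl2 : (x :: l).getLast? = (b :: t).getLast? := by
            rw [e, List.getLast?_append_of_ne_nil _ (by simp)]
          rw [hl'] at hl2
          rw [List.head?_reverse, ← hl2]
          simpa using h2.symm
      · have : ((s ++ [a]) ++ (b :: t).reverse).Perm (x :: l) := by
          rw [h1]
          refine (List.Perm.append_left _ (List.reverse_perm _)).trans (by simp)
        exact this.nodup_iff.2 hnd
      · have hh : (s ++ [a] ++ (b :: t).reverse).head? = some x := by
          have : (x :: l).head? = (s ++ a :: b :: t).head? := by rw [h1]
          rw [List.head?_cons] at this
          rw [this]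
          cases s <;> simp
        rw [hh, List.getLast?_append_of_ne_nil _ (by simp), List.getLast?_reverse]
        simpa using h3.symm
      · rw [h1]
        exact (List.Perm.append_left _ (List.reverse_perm _)).trans (by simp)
    obtain ⟨c, hc1, hc2, hc3, hc4⟩ := hcyc
    let S := (x :: l).toFinset
    have hSA : S ⊆ A := by intro a ha; exact hpA a (by simpa [S] using ha)
    have hScard : S.card = (x :: l).length := List.toFinset_card_of_nodup hnd
    have hclosed : ∀ y ∈ A, ∀ w ∈ S, G.Adj y w → y ∈ S := by
      intro y hy w hw hyw
      by_contra hn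
      have hw' : w ∈ c := hc4.mem_iff.2 (by simpa [S] using hw)
      have hn' : y ∉ c := fun h => hn (by simpa [S] using hc4.mem_iff.1 h)
      obtain ⟨q, q1, q2, q3, q4⟩ := aux_rot G c hc1 hc2 hc3 y w hw' hn' hyw
      have := hmax q q1 q2 (by
        intro a ha
        rcases q4 a ha with rfl | h
        · exact hy
        · exact hpA a (hc4.mem_iff.1 h))
      rw [q3, hc4.length_eq] at this
      omega
    have hcS := Finset.card_sdiff_add_card_eq_card hSA
    have hSpos : 0 < S.card := by rw [hScard]; simp
    have h5 := ih (A \ S).card (by omega) (A \ S) rfl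
      (fun p h1 h2 h3 => hp p h1 h2 (fun a ha => (Finset.mem_sdiff.1 (h3 a ha)).1))
    rw [← Finset.sum_sdiff hSA, ← hcS, mul_add]
    refine add_le_add (le_trans (le_of_eq ?_) h5) ?_
    · refine Finset.sum_congr rfl fun a ha => ?_
      congr 1
      ext b
      simp only [Finset.mem_filter, Finset.mem_sdiff] at ha ⊢
      constructor
      · rintro ⟨k1, k2⟩
        exact ⟨⟨k1, fun k => ha.2 (hclosed a ha.1 b k k2)⟩, k2⟩
      · rintro ⟨k1, k2⟩; exact ⟨k1.1, k2⟩
    · rw [mul_comm, ← smul_eq_mul]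
      refine Finset.sum_le_card_nsmul _ _ _ fun a ha => ?_
      have : A.filter (G.Adj a) ⊆ S.erase a := by
        intro b hb
        simp only [Finset.mem_filter, Finset.mem_erase] at hb ⊢
        exact ⟨hb.2.ne', hclosed b hb.1 a ha hb.2.symm⟩
      have := Finset.card_le_card this
      rw [Finset.card_erase_of_mem ha] at this
      omega

lemma aux_walk {V : Type*} (G : SimpleGraph V) : ∀ (l : List V) (x : V),
    (x :: l).IsChain G.Adj → ∃ (z : V) (w : G.Walk x z), w.support = x :: l := by
  intro l
  induction l with
  | nil => intro x _; exact ⟨x, .nil, rfl⟩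
  | cons y l ih =>
    intro x h
    rw [List.isChain_cons_cons] at h
    obtain ⟨z, w, hw⟩ := ih y h.2
    exact ⟨z, .cons h.1 w, by simp [hw]⟩

lemma aux_cycle {V : Type*} (G : SimpleGraph V) (k : ℕ) (hk : 3 ≤ k) (v : V) (p : List V)
    (hch : p.IsChain G.Adj) (hnd : p.Nodup) (hv : ∀ a ∈ p, G.Adj v a) (hl : p.length = k - 1) :
    ∃ (u : V) (w : G.Walk u u), w.IsCycle ∧ w.length = k := by
  match p, hl with
  | [], hl => simp at hl; omega
  | x :: l, hl =>
    obtain ⟨z, w, hw⟩ := aux_walk G l x hch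
    have hvx : G.Adj v x := hv x (by simp)
    have hzm : z ∈ x :: l := hw ▸ w.end_mem_support
    have hvz : G.Adj v z := hv z hzm
    have hvn : v ∉ w.support := by rw [hw]; intro h; exact (hv v h).ne rfl
    have hlen : w.length + 1 = k - 1 := by rw [← w.length_support, hw, hl]
    have hwp : w.IsPath := by rw [SimpleGraph.Walk.isPath_def, hw]; exact hnd
    refine ⟨z, .cons hvz.symm (.cons hvx w), ?_, by simp; omega⟩
    rw [SimpleGraph.Walk.cons_isCycle_iff]
    refine ⟨by rw [SimpleGraph.Walk.cons_isPath_iff]; exact ⟨hwp, hvn⟩, ?_⟩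
    rw [SimpleGraph.Walk.edges_cons, List.mem_cons]
    rintro (h | h)
    · have hzx : z = x := by
        simp at h
        rcases h with ⟨h1, h2⟩ | h
        · rw [h1, h2]
        · exact h
      subst hzx
      have h0 : w = .nil := by simpa using hwp
      rw [h0] at hlen
      simp at hlen; omega
    · exact hvn (w.snd_mem_support_of_mem_edges h)

lemma aux_tri {V : Type*} [Fintype V] [DecidableEq V]
    (G : SimpleGraph V) [DecidableRel G.Adj] :
    6 * (G.cliqueFinset 3).card ≤
      ∑ v, ∑ a ∈ G.neighborFinset v, ((G.neighborFinset v).filter (G.Adj a)).card := by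
  let T : Finset (V × V × V) := Finset.univ.filter
    fun x => G.Adj x.1 x.2.1 ∧ G.Adj x.1 x.2.2 ∧ G.Adj x.2.1 x.2.2
  have hT : T.card =
      ∑ v, ∑ a ∈ G.neighborFinset v, ((G.neighborFinset v).filter (G.Adj a)).card := by
    simp only [T, Finset.card_filter, Fintype.sum_prod_type]
    refine Finset.sum_congr rfl fun v _ => ?_
    rw [G.neighborFinset_eq_filter, Finset.sum_filter]
    refine Finset.sum_congr rfl fun a _ => ?_
    rw [Finset.sum_filter]
    split_ifs with h
    · refine Finset.sum_congr rfl fun b _ => ?_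
      simp only [h, true_and]
      split_ifs <;> tauto
    · simp [h]
  rw [← hT, mul_comm]
  have hmaps : ∀ x ∈ T, ({x.1, x.2.1, x.2.2} : Finset V) ∈ G.cliqueFinset 3 := by
    intro x hx
    simp only [T, Finset.mem_filter, Finset.mem_univ, true_and] at hx
    rw [SimpleGraph.mem_cliqueFinset_iff, SimpleGraph.is3Clique_triple_iff]
    exact hx
  rw [Finset.card_eq_sum_card_fiberwise hmaps, ← smul_eq_mul]
  refine Finset.card_nsmul_le_sum _ _ _ fun s hs => ?_
  rw [SimpleGraph.mem_cliqueFinset_iff, SimpleGraph.is3Clique_iff] at hs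
  obtain ⟨a, b, c, hab, hac, hbc, rfl⟩ := hs
  have h6 : ({(a,b,c),(a,c,b),(b,a,c),(b,c,a),(c,a,b),(c,b,a)} : Finset (V × V × V)).card = 6 := by
    have := hab.ne; have := hac.ne; have := hbc.ne
    have := hab.ne'; have := hac.ne'; have := hbc.ne'
    simp [Finset.card_insert_of_notMem, *]
  rw [← h6]
  apply Finset.card_le_card
  intro x hx
  simp only [Finset.mem_insert, Finset.mem_singleton] at hx
  have := hab.symm; have := hac.symm; have := hbc.symm
  simp only [T, Finset.mem_filter, Finset.mem_univ, true_and]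
  rcases hx with rfl | rfl | rfl | rfl | rfl | rfl <;>
    refine ⟨⟨by assumption, by assumption, by assumption⟩, ?_⟩ <;> ext <;> simp <;> tauto

/-- **Claim (triangles in cycle-free graphs).** Let `k ≥ 3` and let `G` be a `C_k`-free
graph with `m` edges, i.e. `G` contains no cycle of length `k`. Then the number of
triangles satisfies `t(G) ≤ (k−3)·m/3`. -/
theorem stmt_10 {V : Type*} [Fintype V] [DecidableEq V]
    (G : SimpleGraph V) [DecidableRel G.Adj]
    (k : ℕ) (hk : 3 ≤ k)
    (hCk : ∀ (v : V) (w : G.Walk v v), w.IsCycle → w.length ≠ k)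
    (m : ℕ) (hm : G.edgeFinset.card = m) :
    ((G.cliqueFinset 3).card : ℝ) ≤ ((k : ℝ) - 3) * (m : ℝ) / 3 := by
  have h1 : ∀ v ∈ (Finset.univ : Finset V),
      ∑ a ∈ G.neighborFinset v, ((G.neighborFinset v).filter (G.Adj a)).card ≤
      (k - 3) * G.degree v := by
    intro v _
    have := aux_EG G (k - 2) (by omega) _ (G.neighborFinset v) rfl (by
      intro p p1 p2 p3 p4
      obtain ⟨u, w, w1, w2⟩ := aux_cycle G k hk v p p1 p2 (fun a ha => by simpa using p3 a ha)
        (by omega)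
      exact hCk u w w1 w2)
    rw [G.card_neighborFinset_eq_degree] at this
    exact this
  have h2 := (aux_tri G).trans (Finset.sum_le_sum h1)
  rw [← Finset.mul_sum, G.sum_degrees_eq_twice_card_edges, hm] at h2
  obtain ⟨j, rfl⟩ := Nat.exists_eq_add_of_le hk
  rw [Nat.add_sub_cancel_left] at h2
  have h3 : (6 : ℝ) * ((G.cliqueFinset 3).card : ℝ) ≤ j * (2 * m) := by exact_mod_cast h2
  push_cast
  linarith
end

section
/- Let x = (x₁, …, xₙ) and y = (y₁, …, yₙ) be vectors in ℝⁿ with nonnegative entries arranged in non-increasing order, and suppose y is weakly majorized by x, i.e., Σ_{j=1}^{k} y_j ≤ Σ_{j=1}^{k} x_j for all 1 ≤ k ≤ n. Then for every real number p > 1, ‖y‖_p ≤ ‖x‖_p, and equality holds if and only if x = y. -/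
theorem aux_tangent {a b p : ℝ} (ha : 0 ≤ a) (hb : 0 ≤ b) (hp : 1 < p) (hab : a ≠ b) :
    b ^ p + p * (b ^ (p - 1) * (a - b)) < a ^ p := by
  rcases hb.eq_or_lt with rfl | hb
  · have : 0 < a := lt_of_le_of_ne ha (Ne.symm hab)
    rw [Real.zero_rpow (by linarith), Real.zero_rpow (by linarith)]
    have := Real.rpow_pos_of_pos this p
    linarith
  · have h1 : 1 + p * (a / b - 1) < (1 + (a / b - 1)) ^ p := by
      apply one_add_mul_self_lt_rpow_one_add _ _ hp
      · have := div_nonneg ha hb.le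
        linarith
      · intro h
        apply hab
        have h2 : a / b = 1 := by linarith
        exact (div_eq_one_iff_eq hb.ne').mp h2
    have h3 : 1 + (a / b - 1) = a / b := by ring
    rw [h3, Real.div_rpow ha hb.le, lt_div_iff₀ (Real.rpow_pos_of_pos hb p)] at h1
    have h4 : b ^ p = b ^ (p - 1) * b := by
      rw [← Real.rpow_add_one hb.ne']; congr 1; ring
    have h5 : (1 + p * (a / b - 1)) * b ^ p = b ^ p + p * (b ^ (p - 1) * (a - b)) := by
      rw [h4]; field_simp
    linarith

theorem aux_abel (n : ℕ) (c d : Fin n → ℝ) (hc : Antitone c)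
    (hd : ∀ k : ℕ, k ≤ n → 0 ≤ ∑ j ∈ Finset.univ.filter (fun j : Fin n => (j : ℕ) < k), d j) :
    ∀ k : ℕ, k ≤ n → ∀ c0 : ℝ, (∀ j : Fin n, (j : ℕ) < k → c0 ≤ c j) →
      c0 * ∑ j ∈ Finset.univ.filter (fun j : Fin n => (j : ℕ) < k), d j ≤
        ∑ j ∈ Finset.univ.filter (fun j : Fin n => (j : ℕ) < k), c j * d j := by
  intro k
  induction k with
  | zero => intro _ c0 _; simp
  | succ k ih =>
    intro hk c0 h0
    have hS := hd (k + 1) hk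
    have e : Finset.univ.filter (fun j : Fin n => (j : ℕ) < k + 1) =
        insert (⟨k, hk⟩ : Fin n) (Finset.univ.filter (fun j : Fin n => (j : ℕ) < k)) := by
      ext j
      simp [Fin.ext_iff]
      omega
    have hn : (⟨k, hk⟩ : Fin n) ∉ Finset.univ.filter (fun j : Fin n => (j : ℕ) < k) := by simp
    rw [e, Finset.sum_insert hn] at hS
    rw [e, Finset.sum_insert hn, Finset.sum_insert hn]
    have h1 := ih (by omega) (c ⟨k, hk⟩) (fun j hj => hc (by rw [Fin.le_def]; exact hj.le))
    have h2 := mul_le_mul_of_nonneg_right (h0 ⟨k, hk⟩ (Nat.lt_succ_self k)) hS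
    linarith

/-- **Theorem (p-norms and weak majorization).** Let `x, y ∈ ℝⁿ` have nonnegative
entries arranged in non-increasing order, and suppose `y` is weakly majorized by `x`,
i.e. `∑_{j<k} y j ≤ ∑_{j<k} x j` for all `1 ≤ k ≤ n`. Then for every real `p > 1` we
have `‖y‖_p ≤ ‖x‖_p`, with equality if and only if `x = y`. -/
theorem stmt_12 (n : ℕ) (x y : Fin n → ℝ)
    (hx0 : ∀ i, 0 ≤ x i) (hy0 : ∀ i, 0 ≤ y i)
    (hx : Antitone x) (hy : Antitone y)
    (hmaj : ∀ k : ℕ, 1 ≤ k → k ≤ n →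
      ∑ j ∈ Finset.univ.filter (fun j : Fin n => (j : ℕ) < k), y j ≤
        ∑ j ∈ Finset.univ.filter (fun j : Fin n => (j : ℕ) < k), x j)
    (p : ℝ) (hp : 1 < p) :
    (∑ i, |y i| ^ p) ^ (1 / p) ≤ (∑ i, |x i| ^ p) ^ (1 / p) ∧
      ((∑ i, |y i| ^ p) ^ (1 / p) = (∑ i, |x i| ^ p) ^ (1 / p) ↔ x = y) := by
  have hc : Antitone (fun i => y i ^ (p - 1)) := fun i j hij =>
    Real.rpow_le_rpow (hy0 j) (hy hij) (by linarith)
  have hA : 0 ≤ ∑ j, y j ^ (p - 1) * (x j - y j) := by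
    have h := aux_abel n (fun i => y i ^ (p - 1)) (fun j => x j - y j) hc (by
      intro k hk
      rw [Finset.sum_sub_distrib, sub_nonneg]
      rcases Nat.eq_zero_or_pos k with rfl | h
      · simp
      · exact hmaj k h hk) n le_rfl 0 (fun j _ => Real.rpow_nonneg (hy0 j) _)
    simpa using h
  have hxa : ∀ i, |x i| = x i := fun i => abs_of_nonneg (hx0 i)
  have hya : ∀ i, |y i| = y i := fun i => abs_of_nonneg (hy0 i)
  simp only [hxa, hya]
  have hY : 0 ≤ ∑ i, y i ^ p := Finset.sum_nonneg fun i _ => Real.rpow_nonneg (hy0 i) _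
  have hp' : 0 < 1 / p := by positivity
  have hlt : x ≠ y → ∑ i, y i ^ p < ∑ i, x i ^ p := by
    intro hne
    obtain ⟨i, hi⟩ := Function.ne_iff.mp hne
    have h : ∑ i, (y i ^ p + p * (y i ^ (p - 1) * (x i - y i))) < ∑ i, x i ^ p := by
      apply Finset.sum_lt_sum
      · intro j _
        by_cases hj : x j = y j
        · rw [hj]; simp
        · exact (aux_tangent (hx0 j) (hy0 j) hp hj).le
      · exact ⟨i, Finset.mem_univ i, aux_tangent (hx0 i) (hy0 i) hp hi⟩
    rw [Finset.sum_add_distrib, ← Finset.mul_sum] at h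
    have := mul_nonneg (by linarith : (0 : ℝ) ≤ p) hA
    linarith
  by_cases hxy : x = y
  · subst hxy; simp
  · have h := Real.rpow_lt_rpow hY (hlt hxy) hp'
    exact ⟨h.le, fun e => absurd e h.ne, fun e => absurd e hxy⟩
end
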